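/- arXiv:1606.06231 — 4 statements merged into one kernel-verified Lean document; each statement's English description precedes it below -/
import Mathlib

section
/- Let w : ℝ^N → (0,∞) be such that log w is uniformly continuous on ℝ^N, let 1 ≤ p < ∞, and let (θ_n) be a sequence of mollifiers (θ_n ∈ C_0^∞(ℝ^N), θ_n ≥ 0, ∫θ_n = 1, supp θ_n ⊂ B_{1/n}). If u ∈ L^p(ℝ^N; w dx), then θ_n * u ∈ L^p(ℝ^N; w dx) for all n large enough, and θ_n * u → u in L^p(ℝ^N; w dx) as n → ∞. -/
open MeasureTheory Metric Filter Topology ENNReal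

noncomputable section

/-- Euclidean space `ℝ^N`. -/
abbrev Euc (N : ℕ) := EuclideanSpace ℝ (Fin N)

/-- Iterated classical partial derivative along a list of coordinate directions. -/
def pderivList {N : ℕ} : List (Fin N) → (Euc N → ℝ) → Euc N → ℝ
  | [], φ => φ
  | i :: l, φ => pderivList l fun x => fderiv ℝ φ x (EuclideanSpace.single i 1)

/-- `g` is the weak (distributional) partial derivative of `u` of order given by the
list `l` of coordinate directions, i.e. `g = ∂_{l₁} ⋯ ∂_{l_r} u` in `D'(ℝ^N)`. -/
def IsWeakDerivList {N : ℕ} (l : List (Fin N)) (u g : Euc N → ℝ) : Prop :=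
  LocallyIntegrable u volume ∧ LocallyIntegrable g volume ∧
    ∀ φ : Euc N → ℝ, ContDiff ℝ (⊤ : ℕ∞) φ → HasCompactSupport φ →
      ∫ x, u x * pderivList l φ x = (-1 : ℝ) ^ l.length * ∫ x, g x * φ x

/-- `g` is the weak partial derivative `∂ᵢ u`. -/
def IsWeakPartialDeriv {N : ℕ} (i : Fin N) (u g : Euc N → ℝ) : Prop :=
  IsWeakDerivList [i] u g

/-- The weight `(1+|x|)^{-s-N/q}` of the space `L^q_s` (with `N/∞ := 0`). -/
def wt (N : ℕ) (s : ℝ) (q : ℝ≥0∞) (x : Euc N) : ℝ :=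
  (1 + ‖x‖) ^ (-s - (N : ℝ) / q.toReal)

/-- Membership in the weighted space `L^q_s`. -/
def MemLs (N : ℕ) (s : ℝ) (q : ℝ≥0∞) (u : Euc N → ℝ) : Prop :=
  MemLp (fun x => wt N s q x * u x) q volume

/-- The norm of the weighted space `L^q_s`. -/
def LsNorm (N : ℕ) (s : ℝ) (q : ℝ≥0∞) (u : Euc N → ℝ) : ℝ :=
  (eLpNorm (fun x => wt N s q x * u x) q volume).toReal

/-- Membership in the exponentially weighted space `L^q_{exp,s}`. -/
def MemLexp (N : ℕ) (s : ℝ) (q : ℝ≥0∞) (u : Euc N → ℝ) : Prop :=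
  MemLp (fun x => Real.exp (-(s * ‖x‖)) * u x) q volume

/-- The norm of the exponentially weighted space `L^q_{exp,s}`. -/
def LexpNorm (N : ℕ) (s : ℝ) (q : ℝ≥0∞) (u : Euc N → ℝ) : ℝ :=
  (eLpNorm (fun x => Real.exp (-(s * ‖x‖)) * u x) q volume).toReal

/-- The pointwise Euclidean (Frobenius) norm `|∇^k u|` of the `k`-th gradient, whose
components `g m` are indexed by the `k`-tuples `m` of coordinate directions. -/
def gradNormK {N k : ℕ} (g : (Fin k → Fin N) → Euc N → ℝ) (x : Euc N) : ℝ :=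
  Real.sqrt (∑ m : Fin k → Fin N, g m x ^ 2)

/-- The pointwise Euclidean norm `|∇u|` of a first-order gradient. -/
def gradNorm1 {N : ℕ} (g : Fin N → Euc N → ℝ) (x : Euc N) : ℝ :=
  Real.sqrt (∑ i, g i x ^ 2)

/-- The interval `I_{j,p}` of admissible exponents `q`. -/
def Ijp (N j : ℕ) (p : ℝ) : Set ℝ≥0∞ :=
  if p = (N : ℝ) / (j : ℝ) ∧ 1 < N then Set.Ico (ENNReal.ofReal p) ⊤
  else if p < (N : ℝ) / (j : ℝ) then
    Set.Icc (ENNReal.ofReal p) (ENNReal.ofReal ((N : ℝ) * p / ((N : ℝ) - (j : ℝ) * p)))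
  else Set.Icc (ENNReal.ofReal p) ⊤

/-- The average of `u` on the ball `B_ρ`. -/
def ballAvg {N : ℕ} (ρ : ℝ) (u : Euc N → ℝ) : ℝ :=
  (volume (ball (0 : Euc N) ρ)).toReal⁻¹ * ∫ y in ball (0 : Euc N) ρ, u y

/-- The radial symmetrization `u_S(x) = (Nω_N)⁻¹ ∫_{S^{N-1}} u(|x|σ) dσ`. -/
def radialSymmetrization {N : ℕ} (u : Euc N → ℝ) (x : Euc N) : ℝ :=
  ((N : ℝ) * (volume (ball (0 : Euc N) 1)).toReal)⁻¹ *
    ∫ σ : sphere (0 : Euc N) 1, u (‖x‖ • (σ : Euc N)) ∂((volume : Measure (Euc N)).toSphere)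

/-- `u` is radially symmetric: `u x` only depends on `|x|`. -/
def RadSymm {N : ℕ} (u : Euc N → ℝ) : Prop :=
  ∀ x y : Euc N, ‖x‖ = ‖y‖ → u x = u y

/-- Evaluation of a polynomial on `ℝ^N` at a point. -/
def polyEval {N : ℕ} (π : MvPolynomial (Fin N) ℝ) (x : Euc N) : ℝ :=
  MvPolynomial.eval (fun i => x i) π


lemma aux_lintegral_conv {N : ℕ} (w : Euc N → ℝ) (hwc : Continuous w)
    (p : ℝ) (hp : 1 ≤ p) (θ : Euc N → ℝ) (hθc : Continuous θ)
    (hθnonneg : ∀ x, 0 ≤ θ x) (hθint : ∫ x, θ x = 1) (C : ℝ) (hC : 0 ≤ C)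
    (hCw : ∀ x t, θ t ≠ 0 → w x ≤ C * w (x - t))
    (v : Euc N → ℝ) (hv : AEStronglyMeasurable v volume) :
    ∫⁻ x, ‖convolution θ v (ContinuousLinearMap.mul ℝ ℝ) volume x‖ₑ ^ p
        ∂(volume.withDensity fun x => ENNReal.ofReal (w x)) ≤
      ENNReal.ofReal C * ∫⁻ x, ‖v x‖ₑ ^ p ∂(volume.withDensity fun x => ENNReal.ofReal (w x)) := by
  have hp0 : 0 < p := by linarith
  have hWm : Measurable fun x => ENNReal.ofReal (w x) := hwc.measurable.ennreal_ofReal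
  have hTm : Measurable fun x => ENNReal.ofReal (θ x) := hθc.measurable.ennreal_ofReal
  have hTi : ∫⁻ t, ENNReal.ofReal (θ t) = 1 := by
    rw [← ofReal_integral_eq_lintegral_ofReal (integrable_of_integral_eq_one hθint)
      (Eventually.of_forall hθnonneg), hθint, ENNReal.ofReal_one]
  set ν : Measure (Euc N) := volume.withDensity fun x => ENNReal.ofReal (θ x) with hν
  have : IsProbabilityMeasure ν := ⟨by
    rw [hν, withDensity_apply _ MeasurableSet.univ, Measure.restrict_univ, hTi]⟩
  have hVm : ∀ x, AEStronglyMeasurable (fun t => v (x - t)) volume := fun x =>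
    hv.comp_quasiMeasurePreserving (quasiMeasurePreserving_sub_left volume x)
  -- pointwise Jensen inequality
  have hJ : ∀ x, ‖convolution θ v (ContinuousLinearMap.mul ℝ ℝ) volume x‖ₑ ^ p ≤
      ∫⁻ t, ENNReal.ofReal (θ t) * ‖v (x - t)‖ₑ ^ p := by
    intro x
    have hVn : AEStronglyMeasurable (fun t => v (x - t)) ν :=
      (hVm x).mono_ac (withDensity_absolutelyContinuous _ _)
    have h1 : ‖convolution θ v (ContinuousLinearMap.mul ℝ ℝ) volume x‖ₑ ≤
        ∫⁻ t, ‖v (x - t)‖ₑ ∂ν := by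
      rw [convolution_def, hν, lintegral_withDensity_eq_lintegral_mul₀ hTm.aemeasurable
        (hVm x).enorm]
      refine (enorm_integral_le_lintegral_enorm _).trans (le_of_eq ?_)
      refine lintegral_congr fun t => ?_
      simp [enorm_mul, Real.enorm_of_nonneg (hθnonneg t)]
    have h2 := eLpNorm'_le_eLpNorm'_of_exponent_le zero_lt_one hp ν hVn
    simp only [eLpNorm', ENNReal.rpow_one, div_one] at h2
    have h3 : ∫⁻ t, ‖v (x - t)‖ₑ ^ p ∂ν = ∫⁻ t, ENNReal.ofReal (θ t) * ‖v (x - t)‖ₑ ^ p := by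
      rw [hν, lintegral_withDensity_eq_lintegral_mul₀ hTm.aemeasurable
        ((hVm x).enorm.pow_const p)]
      rfl
    rw [← h3]
    calc _ ≤ ((∫⁻ t, ‖v (x - t)‖ₑ ^ p ∂ν) ^ (1 / p)) ^ p :=
          ENNReal.rpow_le_rpow (h1.trans h2) hp0.le
      _ = _ := by rw [← ENNReal.rpow_mul, one_div_mul_cancel hp0.ne', ENNReal.rpow_one]
  have hprod : AEMeasurable (fun z : Euc N × Euc N => ‖v (z.1 - z.2)‖ₑ ^ p)
      ((volume : Measure (Euc N)).prod volume) := by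
    have : AEStronglyMeasurable (fun z : Euc N × Euc N => v (z.1 - z.2))
        ((volume : Measure (Euc N)).prod volume) :=
      hv.comp_quasiMeasurePreserving (quasiMeasurePreserving_sub_of_right_invariant volume volume)
    exact this.enorm.pow_const p
  have hvp : AEMeasurable (fun x => ‖v x‖ₑ ^ p) volume := hv.enorm.pow_const p
  rw [lintegral_withDensity_eq_lintegral_mul₀ hWm.aemeasurable hvp]
  calc _ ≤ ∫⁻ x, ∫⁻ t, ENNReal.ofReal (θ t) * ‖v (x - t)‖ₑ ^ p
          ∂volume ∂(volume.withDensity fun x => ENNReal.ofReal (w x)) := lintegral_mono hJ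
    _ ≤ ∫⁻ x, ENNReal.ofReal (w x) * ∫⁻ t, ENNReal.ofReal (θ t) * ‖v (x - t)‖ₑ ^ p := by
        rw [lintegral_withDensity_eq_lintegral_mul₀ hWm.aemeasurable]
        · rfl
        · exact ((hTm.comp measurable_snd).aemeasurable.mul hprod).lintegral_prod_right'
    _ = ∫⁻ x, ∫⁻ t, ENNReal.ofReal (w x) * (ENNReal.ofReal (θ t) * ‖v (x - t)‖ₑ ^ p) := by
        refine lintegral_congr fun x => ?_
        rw [lintegral_const_mul' _ _ ENNReal.ofReal_ne_top]
    _ = ∫⁻ t, ∫⁻ x, ENNReal.ofReal (w x) * (ENNReal.ofReal (θ t) * ‖v (x - t)‖ₑ ^ p) := by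
        refine lintegral_lintegral_swap ?_
        exact (hWm.comp measurable_fst).aemeasurable.mul
          ((hTm.comp measurable_snd).aemeasurable.mul hprod)
    _ ≤ ∫⁻ t, ENNReal.ofReal (θ t) * (ENNReal.ofReal C *
          ∫⁻ x, ENNReal.ofReal (w x) * ‖v x‖ₑ ^ p) := by
        refine lintegral_mono fun t => ?_
        rw [← lintegral_sub_right_eq_self (fun x => ENNReal.ofReal (w x) * ‖v x‖ₑ ^ p) t,
          ← lintegral_const_mul' _ _ ENNReal.ofReal_ne_top,
          ← lintegral_const_mul' _ _ ENNReal.ofReal_ne_top]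
        refine lintegral_mono fun x => ?_
        by_cases ht : θ t = 0
        · simp [ht]
        · have := ENNReal.ofReal_le_ofReal (hCw x t ht)
          rw [ENNReal.ofReal_mul hC] at this
          calc _ ≤ (ENNReal.ofReal C * ENNReal.ofReal (w (x - t))) *
                (ENNReal.ofReal (θ t) * ‖v (x - t)‖ₑ ^ p) := by gcongr
            _ = _ := by ring
    _ = _ := by
        rw [lintegral_mul_const _ hTm, hTi, one_mul]
        rfl

lemma aux_eLpNorm_conv {N : ℕ} (w : Euc N → ℝ) (hwc : Continuous w)
    (p : ℝ) (hp : 1 ≤ p) (θ : Euc N → ℝ) (hθc : Continuous θ)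
    (hθnonneg : ∀ x, 0 ≤ θ x) (hθint : ∫ x, θ x = 1) (C : ℝ) (hC : 0 ≤ C)
    (hCw : ∀ x t, θ t ≠ 0 → w x ≤ C * w (x - t))
    (v : Euc N → ℝ) (hv : AEStronglyMeasurable v volume) :
    eLpNorm (convolution θ v (ContinuousLinearMap.mul ℝ ℝ) volume) (ENNReal.ofReal p)
        (volume.withDensity fun x => ENNReal.ofReal (w x)) ≤
      ENNReal.ofReal C ^ (1 / p) * eLpNorm v (ENNReal.ofReal p)
        (volume.withDensity fun x => ENNReal.ofReal (w x)) := by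
  have hp0 : 0 < p := by linarith
  have h0 : ENNReal.ofReal p ≠ 0 := by simpa using hp0
  rw [eLpNorm_eq_lintegral_rpow_enorm_toReal h0 ENNReal.ofReal_ne_top,
    eLpNorm_eq_lintegral_rpow_enorm_toReal h0 ENNReal.ofReal_ne_top,
    ENNReal.toReal_ofReal hp0.le, ← ENNReal.mul_rpow_of_nonneg _ _ (by positivity)]
  exact ENNReal.rpow_le_rpow
    (aux_lintegral_conv w hwc p hp θ hθc hθnonneg hθint C hC hCw v hv) (by positivity)

lemma aux_locInt {N : ℕ} (w : Euc N → ℝ) (hw : ∀ x, 0 < w x) (hwc : Continuous w)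
    (u : Euc N → ℝ)
    (hu : LocallyIntegrable u (volume.withDensity fun x => ENNReal.ofReal (w x))) :
    LocallyIntegrable u volume := by
  have hWm : Measurable fun x => ENNReal.ofReal (w x) := hwc.measurable.ennreal_ofReal
  have h1 : LocallyIntegrable (fun x => w x * u x) volume := by
    rw [locallyIntegrable_iff] at hu ⊢
    intro K hK
    have := hu K hK
    rw [IntegrableOn, restrict_withDensity hK.measurableSet,
      integrable_withDensity_iff_integrable_smul' hWm (by simp)] at this
    refine this.congr (Eventually.of_forall fun x => ?_)
    simp [ENNReal.toReal_ofReal (hw x).le]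
  have h2 := h1.continuous_mul (hwc.inv₀ fun x => (hw x).ne')
  convert h2 using 1
  ext x
  simp [(hw x).ne']

lemma aux_conv_cpt {N : ℕ} (μ : Measure (Euc N)) [IsLocallyFiniteMeasure μ]
    (p : ℝ) (θ : ℕ → Euc N → ℝ)
    (hθnonneg : ∀ n x, 0 ≤ θ n x)
    (hθint : ∀ n, ∫ x, θ n x = 1)
    (hθsupp : ∀ n : ℕ, 1 ≤ n → tsupport (θ n) ⊆ ball (0 : Euc N) (1 / (n : ℝ)))
    (g : Euc N → ℝ) (hg : Continuous g) (hgc : HasCompactSupport g) :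
    Tendsto (fun n => eLpNorm (convolution (θ n) g (ContinuousLinearMap.mul ℝ ℝ) volume - g)
          (ENNReal.ofReal p) μ) atTop (nhds 0) := by
  set K := cthickening 1 (tsupport g) with hK
  have hKc : IsCompact K := IsCompact.cthickening hgc
  have hgu : UniformContinuous g := hgc.uniformContinuous_of_continuous hg
  set M := μ K ^ (1 / (ENNReal.ofReal p).toReal) with hM
  have hMt : M ≠ ⊤ := ENNReal.rpow_ne_top_of_nonneg (by positivity) hKc.measure_lt_top.ne
  -- bound for each positive real
  have hb : ∀ c : ℝ, 0 < c → ∀ᶠ n in atTop,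
      eLpNorm (convolution (θ n) g (ContinuousLinearMap.mul ℝ ℝ) volume - g)
          (ENNReal.ofReal p) μ ≤ ENNReal.ofReal c * M := by
    intro c hc
    obtain ⟨δ, hδ, hδg⟩ := Metric.uniformContinuous_iff.1 hgu c hc
    have hlim : ∀ᶠ n : ℕ in atTop, 1 / (n : ℝ) < δ :=
      tendsto_one_div_atTop_nhds_zero_nat.eventually (gt_mem_nhds hδ)
    filter_upwards [hlim, eventually_ge_atTop 1] with n hn hn1
    have hsb : Function.support (θ n) ⊆ ball 0 (1 / (n : ℝ)) :=
      (subset_tsupport _).trans (hθsupp n hn1)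
    have hn1' : 1 / (n : ℝ) ≤ 1 := by
      have : (1 : ℝ) ≤ n := by exact_mod_cast hn1
      rw [div_le_one (by linarith)]; exact this
    refine eLpNorm_sub_le_of_dist_bdd μ ENNReal.ofReal_ne_top hKc.measurableSet hc.le
      (fun x => ?_) ?_ ?_
    · refine dist_convolution_le hc.le hsb (hθnonneg n) (hθint n) hg.aestronglyMeasurable ?_
      intro y hy
      exact (hδg ((mem_ball.1 hy).trans hn)).le
    · refine (support_convolution_subset_swap _).trans ?_
      rintro _ ⟨a, ha, b, hb, rfl⟩
      refine mem_cthickening_of_dist_le _ a _ _ (subset_tsupport _ ha) ?_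
      have := mem_ball_zero_iff.1 (hsb hb)
      simp only [dist_self_add_left]
      linarith
    · exact (subset_tsupport _).trans (self_subset_cthickening _)
  rw [ENNReal.tendsto_nhds_zero]
  intro ε hε
  obtain ⟨c, hc, hcε⟩ : ∃ c : ℝ, 0 < c ∧ ENNReal.ofReal c * M ≤ ε := by
    obtain ⟨c, hc, hcε⟩ := ENNReal.exists_nnreal_pos_mul_lt hMt hε.ne'
    exact ⟨c, by exact_mod_cast hc, by simpa using hcε.le⟩
  filter_upwards [hb c hc] with n hn using hn.trans hcε

/-- If `log w` is uniformly continuous, `1 ≤ p < ∞` and `(θ n)` is a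
sequence of mollifiers with `supp θ n ⊆ B_{1/n}`, then for `u ∈ L^p(ℝ^N; w dx)` the
mollifications `θ n * u` belong to `L^p(ℝ^N; w dx)` for `n` large and converge to `u`
in `L^p(ℝ^N; w dx)`. -/
theorem stmt_0 {N : ℕ} (hN : 1 ≤ N) (w : Euc N → ℝ) (hw : ∀ x, 0 < w x)
    (hlog : UniformContinuous fun x => Real.log (w x))
    (p : ℝ) (hp : 1 ≤ p)
    (θ : ℕ → Euc N → ℝ)
    (hθsmooth : ∀ n, ContDiff ℝ (⊤ : ℕ∞) (θ n))
    (hθcompact : ∀ n, HasCompactSupport (θ n))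
    (hθnonneg : ∀ n x, 0 ≤ θ n x)
    (hθint : ∀ n, ∫ x, θ n x = 1)
    (hθsupp : ∀ n : ℕ, 1 ≤ n → tsupport (θ n) ⊆ ball (0 : Euc N) (1 / (n : ℝ)))
    (u : Euc N → ℝ)
    (hu : MemLp u (ENNReal.ofReal p) (volume.withDensity fun x => ENNReal.ofReal (w x))) :
    (∀ᶠ n in atTop, MemLp (convolution (θ n) u (ContinuousLinearMap.mul ℝ ℝ) volume)
        (ENNReal.ofReal p) (volume.withDensity fun x => ENNReal.ofReal (w x))) ∧
      Tendsto
        (fun n => eLpNorm (convolution (θ n) u (ContinuousLinearMap.mul ℝ ℝ) volume - u)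
          (ENNReal.ofReal p) (volume.withDensity fun x => ENNReal.ofReal (w x)))
        atTop (nhds 0) := by
  have hwe : ∀ x, w x = Real.exp (Real.log (w x)) := fun x => (Real.exp_log (hw x)).symm
  have hwc : Continuous w := by
    rw [show w = fun x => Real.exp (Real.log (w x)) from funext hwe]
    exact Real.continuous_exp.comp hlog.continuous
  have hp1 : (1 : ℝ≥0∞) ≤ ENNReal.ofReal p := by simpa using hp
  have hp0 : 0 < p := by linarith
  set μ : Measure (Euc N) := volume.withDensity fun x => ENNReal.ofReal (w x) with hμ
  have : IsLocallyFiniteMeasure μ := IsLocallyFiniteMeasure.withDensity_ofReal hwc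
  have huL : LocallyIntegrable u volume := aux_locInt w hw hwc u (hu.locallyIntegrable hp1)
  have hθc : ∀ n, Continuous (θ n) := fun n => (hθsmooth n).continuous
  set E : ℝ≥0∞ := ENNReal.ofReal (Real.exp 1) ^ (1 / p) with hE
  have hEt : E ≠ ⊤ := ENNReal.rpow_ne_top_of_nonneg (by positivity) ENNReal.ofReal_ne_top
  have hbound : ∀ᶠ n in atTop, ∀ v : Euc N → ℝ, AEStronglyMeasurable v volume →
      eLpNorm (convolution (θ n) v (ContinuousLinearMap.mul ℝ ℝ) volume) (ENNReal.ofReal p) μ ≤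
        E * eLpNorm v (ENNReal.ofReal p) μ := by
    obtain ⟨δ, hδ, hδw⟩ := Metric.uniformContinuous_iff.1 hlog 1 one_pos
    have hlim : ∀ᶠ n : ℕ in atTop, 1 / (n : ℝ) < δ :=
      tendsto_one_div_atTop_nhds_zero_nat.eventually (gt_mem_nhds hδ)
    filter_upwards [hlim, eventually_ge_atTop 1] with n hn hn1 v hv
    refine aux_eLpNorm_conv w hwc p hp (θ n) (hθc n) (hθnonneg n) (hθint n) _
      (Real.exp_pos 1).le ?_ v hv
    intro x t ht
    have htb := mem_ball_zero_iff.1 (hθsupp n hn1 (subset_tsupport _ ht))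
    have hd : dist x (x - t) < δ := by
      rw [dist_eq_norm, show x - (x - t) = t by abel]
      linarith
    have := hδw hd
    rw [Real.dist_eq] at this
    have h2 := (abs_lt.1 this).2
    rw [hwe x, hwe (x - t), ← Real.exp_add]
    exact Real.exp_le_exp.2 (by linarith)
  have hcm : ∀ n (v : Euc N → ℝ), LocallyIntegrable v volume → AEStronglyMeasurable
      (convolution (θ n) v (ContinuousLinearMap.mul ℝ ℝ) volume) μ := fun n v hv =>
    ((hθcompact n).continuous_convolution_left _ (hθc n) hv).aestronglyMeasurable
  refine ⟨?_, ?_⟩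
  · filter_upwards [hbound] with n hn
    exact ⟨hcm n u huL, (hn u huL.aestronglyMeasurable).trans_lt
      (ENNReal.mul_lt_top hEt.lt_top hu.2)⟩
  · rw [ENNReal.tendsto_nhds_zero]
    intro ε hε
    have hE1 : E + 1 ≠ ⊤ := by simpa using hEt
    have hε2 : ε / 2 ≠ 0 := (ENNReal.half_pos hε.ne').ne'
    obtain ⟨c, hc, hcε⟩ := ENNReal.exists_nnreal_pos_mul_lt hE1 hε2
    obtain ⟨g, hgc, hgu, hg, hgm⟩ := hu.exists_hasCompactSupport_eLpNorm_sub_le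
      ENNReal.ofReal_ne_top (ε := (c : ℝ≥0∞)) (by exact_mod_cast hc.ne')
    have hgL : LocallyIntegrable g volume := hg.locallyIntegrable
    have hlim := ENNReal.tendsto_nhds_zero.1
      (aux_conv_cpt μ p θ hθnonneg hθint hθsupp g hg hgc) (ε / 2) (ENNReal.half_pos hε.ne')
    filter_upwards [hbound, hlim] with n hn hl
    have hex : ∀ v : Euc N → ℝ, LocallyIntegrable v volume →
        ConvolutionExists (θ n) v (ContinuousLinearMap.mul ℝ ℝ) volume := fun v hv =>
      (hθcompact n).convolutionExists_left _ (hθc n) hv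
    have hugL : LocallyIntegrable (u - g) volume := huL.sub hgL
    have hadd := (hex _ hugL).distrib_add (hex g hgL)
    rw [sub_add_cancel] at hadd
    have hdec : convolution (θ n) u (ContinuousLinearMap.mul ℝ ℝ) volume - u =
        (convolution (θ n) (u - g) (ContinuousLinearMap.mul ℝ ℝ) volume +
          (convolution (θ n) g (ContinuousLinearMap.mul ℝ ℝ) volume - g)) - (u - g) := by
      rw [hadd]; abel
    rw [hdec]
    have hm1 := hcm n _ hugL
    have hm2 := (hcm n _ hgL).sub (hg.aestronglyMeasurable (μ := μ))
    have hm3 := hu.1.sub (hg.aestronglyMeasurable (μ := μ))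
    have hb := hn _ hugL.aestronglyMeasurable
    calc _ ≤ _ := eLpNorm_sub_le (hm1.add hm2) hm3 hp1
      _ ≤ _ := add_le_add_left (eLpNorm_add_le hm1 hm2 hp1) _
      _ ≤ (E * c + ε / 2) + c := by
          gcongr
          exact hb.trans (by gcongr)
      _ = c * (E + 1) + ε / 2 := by ring
      _ ≤ ε / 2 + ε / 2 := by gcongr
      _ = ε := ENNReal.add_halves ε

end
end

section
/- Let N ≥ 1 be an integer, s > -1, 1 ≤ p < ∞, p ≤ q < ∞ and ρ > 0. Then there is a constant C > 0 such that, for every locally absolutely continuous function f on [ρ,∞), (∫_ρ^∞ (1+r)^{-(s+1)q-N} r^{N-1} |f(r)-f(ρ)|^q dr)^{1/q} ≤ C (∫_ρ^∞ (1+r)^{-sp-N} r^{N-1} |f'(r)|^p dr)^{1/p}. -/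
open MeasureTheory Metric Filter Topology ENNReal

noncomputable section

theorem hardy_int_head (a ρ r : ℝ) (ha : 0 < a) (hρ : 0 < ρ) (hr : ρ ≤ r) :
    ∫⁻ t in Set.Ioc ρ r, ENNReal.ofReal (t ^ (a - 1)) ≤ ENNReal.ofReal (r ^ a / a) := by
  have hint : IntervalIntegrable (fun t : ℝ => t ^ (a - 1)) volume ρ r :=
    intervalIntegral.intervalIntegrable_rpow' (by linarith)
  rw [← ofReal_integral_eq_lintegral_ofReal]
  · apply ENNReal.ofReal_le_ofReal
    rw [← intervalIntegral.integral_of_le hr, integral_rpow (Or.inl (by linarith))]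
    rw [sub_add_cancel]
    have : 0 ≤ ρ ^ a := by positivity
    gcongr
    linarith
  · exact (intervalIntegrable_iff_integrableOn_Ioc_of_le hr).1 hint
  · filter_upwards [ae_restrict_mem measurableSet_Ioc] with t ht
    have : 0 < t := hρ.trans ht.1
    positivity

theorem hardy_int_tail (a t : ℝ) (ha : 0 < a) (ht : 0 < t) :
    ∫⁻ r in Set.Ioi t, ENNReal.ofReal (r ^ (-a - 1)) = ENNReal.ofReal (t ^ (-a) / a) := by
  rw [← ofReal_integral_eq_lintegral_ofReal]
  · rw [integral_Ioi_rpow_of_lt (by linarith) ht]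
    rw [sub_add_cancel, neg_div_neg_eq]
  · exact integrableOn_Ioi_rpow_of_lt (by linarith) ht
  · filter_upwards [ae_restrict_mem measurableSet_Ioi] with r hr
    have : 0 < r := ht.trans hr
    positivity

theorem hardy_holder (a p ρ r : ℝ) (ha : 0 < a) (hp : 1 ≤ p) (hρ : 0 < ρ) (hr : ρ ≤ r)
    (g : ℝ → ℝ≥0∞) (hg : Measurable g) :
    (∫⁻ t in Set.Ioc ρ r, g t) ^ p ≤ ENNReal.ofReal ((r ^ a / a) ^ (p - 1)) *
      ∫⁻ t in Set.Ioc ρ r, ENNReal.ofReal (t ^ ((1 - a) * (p - 1))) * g t ^ p := by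
  rcases hp.eq_or_lt with rfl | hp1
  · simp
  have hr0 : 0 < r := hρ.trans_le hr
  obtain ⟨p', hpp⟩ : ∃ p', p.HolderConjugate p' :=
    ⟨_, Real.HolderConjugate.conjExponent hp1⟩
  have hp0 : 0 < p := by linarith
  have hp'0 : 0 < p' := hpp.symm.pos
  have e1 : p / p' = p - 1 := by
    have := hpp.symm.div_conj_eq_sub_one
    have h2 := hpp.div_conj_eq_sub_one
    linarith
  have H := ENNReal.lintegral_mul_le_Lp_mul_Lq (volume.restrict (Set.Ioc ρ r)) hpp.symm
    (f := fun t => ENNReal.ofReal (t ^ ((a - 1) / p')))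
    (g := fun t => ENNReal.ofReal (t ^ ((1 - a) / p')) * g t)
    (by fun_prop) (by fun_prop)
  have h0 : ∫⁻ t in Set.Ioc ρ r, g t = ∫⁻ t in Set.Ioc ρ r,
      ((fun t => ENNReal.ofReal (t ^ ((a - 1) / p'))) *
        (fun t => ENNReal.ofReal (t ^ ((1 - a) / p')) * g t)) t := by
    apply setLIntegral_congr_fun measurableSet_Ioc
    intro t ht
    have ht0 : 0 < t := hρ.trans ht.1
    simp only [Pi.mul_apply]
    rw [← mul_assoc, ← ENNReal.ofReal_mul (by positivity), ← Real.rpow_add ht0]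
    rw [show (a - 1) / p' + (1 - a) / p' = 0 by ring]
    simp
  have h1 : ∫⁻ t in Set.Ioc ρ r, (ENNReal.ofReal (t ^ ((a - 1) / p'))) ^ p' =
      ∫⁻ t in Set.Ioc ρ r, ENNReal.ofReal (t ^ (a - 1)) := by
    apply setLIntegral_congr_fun measurableSet_Ioc
    intro t ht
    have ht0 : 0 < t := hρ.trans ht.1
    simp only
    rw [ENNReal.ofReal_rpow_of_nonneg (by positivity) hp'0.le, ← Real.rpow_mul ht0.le,
      div_mul_cancel₀ _ hp'0.ne']
  have h2 : ∫⁻ t in Set.Ioc ρ r, (ENNReal.ofReal (t ^ ((1 - a) / p')) * g t) ^ p =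
      ∫⁻ t in Set.Ioc ρ r, ENNReal.ofReal (t ^ ((1 - a) * (p - 1))) * g t ^ p := by
    apply setLIntegral_congr_fun measurableSet_Ioc
    intro t ht
    have ht0 : 0 < t := hρ.trans ht.1
    simp only
    rw [ENNReal.mul_rpow_of_nonneg _ _ hp0.le,
      ENNReal.ofReal_rpow_of_nonneg (by positivity) hp0.le, ← Real.rpow_mul ht0.le,
      ← e1]
    congr 3
    ring
  rw [← h0, h1, h2] at H
  calc _ ≤ _ := ENNReal.rpow_le_rpow H hp0.le
    _ ≤ _ := by
      rw [ENNReal.mul_rpow_of_nonneg _ _ hp0.le, ← ENNReal.rpow_mul, ← ENNReal.rpow_mul,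
        one_div_mul_cancel hp0.ne', ENNReal.rpow_one, ← ENNReal.ofReal_rpow_of_nonneg
          (by positivity) (by linarith), one_div_mul_eq_div, e1]
      gcongr
      exact hardy_int_head a ρ r ha hρ hr

theorem hardy_core (a p q ρ : ℝ) (ha : 0 < a) (hp : 1 ≤ p) (hpq : p ≤ q) (hρ : 0 < ρ)
    (g : ℝ → ℝ≥0∞) (hg : Measurable g) :
    ∫⁻ r in Set.Ioi ρ, ENNReal.ofReal (r ^ (-a * q - 1)) * (∫⁻ t in Set.Ioc ρ r, g t) ^ q
      ≤ ENNReal.ofReal (1 / a) * (ENNReal.ofReal ((1 / a) ^ (p - 1)) *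
        ∫⁻ t in Set.Ioi ρ, ENNReal.ofReal (t ^ (-(a - 1) * p - 1)) * g t ^ p) ^ (q / p) := by
  have hp0 : 0 < p := by linarith
  set c := ENNReal.ofReal ((1 / a) ^ (p - 1)) with hc
  set k : ℝ → ℝ≥0∞ := fun t => ENNReal.ofReal (t ^ ((1 - a) * (p - 1))) * g t ^ p with hk
  have hkm : Measurable k := by fun_prop
  set B := ∫⁻ t in Set.Ioi ρ, ENNReal.ofReal (t ^ (-(a - 1) * p - 1)) * g t ^ p with hB
  have hB' : B = ∫⁻ t in Set.Ioi ρ, ENNReal.ofReal (t ^ (-a)) * k t := by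
    apply setLIntegral_congr_fun measurableSet_Ioi
    intro t ht
    have ht0 : 0 < t := hρ.trans ht
    simp only [hk]
    rw [← mul_assoc, ← ENNReal.ofReal_mul (by positivity), ← Real.rpow_add ht0]
    congr 3
    ring
  set X : ℝ → ℝ≥0∞ := fun r => ENNReal.ofReal (r ^ (-a * p)) * (∫⁻ t in Set.Ioc ρ r, g t) ^ p
    with hX
  have hX1 : ∀ r, ρ < r → X r ≤ c * (ENNReal.ofReal (r ^ (-a)) * ∫⁻ t in Set.Ioc ρ r, k t) := by
    intro r hr
    have hr0 : 0 < r := hρ.trans hr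
    calc X r ≤ ENNReal.ofReal (r ^ (-a * p)) * (ENNReal.ofReal ((r ^ a / a) ^ (p - 1)) *
          ∫⁻ t in Set.Ioc ρ r, k t) := by
          simp only [hX]
          gcongr
          exact hardy_holder a p ρ r ha hp hρ hr.le g hg
      _ = _ := by
          rw [← mul_assoc, ← mul_assoc, hc, ← ENNReal.ofReal_mul (by positivity),
            ← ENNReal.ofReal_mul (by positivity)]
          congr 2
          rw [div_eq_mul_one_div, Real.mul_rpow (by positivity) (by positivity),
            ← Real.rpow_mul hr0.le, ← mul_assoc, ← Real.rpow_add hr0, mul_comm]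
          congr 2
          ring
  have hX2 : ∀ r, ρ < r → X r ≤ c * B := by
    intro r hr
    have hr0 : 0 < r := hρ.trans hr
    refine (hX1 r hr).trans ?_
    gcongr
    rw [hB', ← lintegral_const_mul _ hkm]
    calc _ ≤ ∫⁻ t in Set.Ioc ρ r, ENNReal.ofReal (t ^ (-a)) * k t := by
          apply setLIntegral_mono (by fun_prop)
          intro t ht
          have ht0 : 0 < t := hρ.trans ht.1
          gcongr ENNReal.ofReal ?_ * _
          exact Real.rpow_le_rpow_of_nonpos ht0 ht.2 (by linarith)
      _ ≤ _ := lintegral_mono_set Set.Ioc_subset_Ioi_self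
  have hT : ∫⁻ r in Set.Ioi ρ, ENNReal.ofReal (r ^ (-a - 1)) * ∫⁻ t in Set.Ioc ρ r, k t
      = ENNReal.ofReal (1 / a) * B := by
    have s1 : ∀ r ∈ Set.Ioi ρ, ENNReal.ofReal (r ^ (-a - 1)) * ∫⁻ t in Set.Ioc ρ r, k t =
        ∫⁻ t in Set.Ioi ρ, (Set.Ici t).indicator (fun r => ENNReal.ofReal (r ^ (-a - 1))) r * k t := by
      intro r hr
      rw [← lintegral_const_mul _ hkm, ← lintegral_indicator measurableSet_Ioc,
        ← lintegral_indicator measurableSet_Ioi]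
      congr 1
      ext t
      by_cases h1 : ρ < t <;> by_cases h2 : t ≤ r <;> simp [Set.indicator, h1, h2]
    rw [setLIntegral_congr_fun measurableSet_Ioi s1, lintegral_lintegral_swap]
    · rw [hB', ← lintegral_const_mul _ (by fun_prop)]
      apply setLIntegral_congr_fun measurableSet_Ioi
      intro t ht
      have ht0 : 0 < t := hρ.trans ht
      simp only
      rw [lintegral_mul_const _ (Measurable.indicator (by fun_prop) measurableSet_Ici),
        lintegral_indicator measurableSet_Ici, Measure.restrict_restrict measurableSet_Ici]
      rw [Set.inter_eq_self_of_subset_left (Set.Ici_subset_Ioi.2 ht),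
        setLIntegral_congr Ioi_ae_eq_Ici.symm, hardy_int_tail a t ha ht0,
        ← mul_assoc (ENNReal.ofReal (1 / a)) _ (k t),
        ← ENNReal.ofReal_mul (by positivity)]
      congr 2
      ring
    · apply Measurable.aemeasurable
      have : (Function.uncurry fun r t : ℝ =>
          (Set.Ici t).indicator (fun r => ENNReal.ofReal (r ^ (-a - 1))) r * k t) =
          fun z : ℝ × ℝ => {z : ℝ × ℝ | z.2 ≤ z.1}.indicator
            (fun z => ENNReal.ofReal (z.1 ^ (-a - 1))) z * k z.2 := by
        ext z
        simp [Function.uncurry, Set.indicator]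
      rw [this]
      apply Measurable.mul _ (by fun_prop)
      exact Measurable.indicator (by fun_prop) (measurableSet_le measurable_snd measurable_fst)
  have hqp : 1 ≤ q / p := (one_le_div hp0).2 hpq
  have split : ∀ x : ℝ≥0∞, x ^ (q / p) = x * x ^ (q / p - 1) := by
    intro x
    conv_lhs => rw [show q / p = 1 + (q / p - 1) by ring]
    rw [ENNReal.rpow_add_of_nonneg _ _ (by norm_num) (by linarith), ENNReal.rpow_one]
  have hmK : Measurable fun r => ∫⁻ t in Set.Ioc ρ r, k t := by
    apply Monotone.measurable
    intro x y hxy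
    exact lintegral_mono_set (Set.Ioc_subset_Ioc_right hxy)
  calc _ ≤ ∫⁻ r in Set.Ioi ρ, (c * (c * B) ^ (q / p - 1)) *
        (ENNReal.ofReal (r ^ (-a - 1)) * ∫⁻ t in Set.Ioc ρ r, k t) := by
        apply setLIntegral_mono' measurableSet_Ioi
        intro r hr
        have hr0 : 0 < r := hρ.trans hr
        have e : ENNReal.ofReal (r ^ (-a * q - 1)) * (∫⁻ t in Set.Ioc ρ r, g t) ^ q =
            ENNReal.ofReal (r ^ (-1 : ℝ)) * X r ^ (q / p) := by
          simp only [hX]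
          rw [ENNReal.mul_rpow_of_nonneg _ _ (by linarith), ← ENNReal.rpow_mul,
            mul_div_cancel₀ _ hp0.ne', ENNReal.ofReal_rpow_of_nonneg (by positivity) (by linarith),
            ← Real.rpow_mul hr0.le, ← mul_assoc, ← ENNReal.ofReal_mul (by positivity),
            ← Real.rpow_add hr0]
          congr 3
          field_simp
          ring
        rw [e, split]
        calc _ ≤ ENNReal.ofReal (r ^ (-1 : ℝ)) *
              ((c * (ENNReal.ofReal (r ^ (-a)) * ∫⁻ t in Set.Ioc ρ r, k t)) *
                (c * B) ^ (q / p - 1)) := by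
              gcongr
              · exact hX1 r hr
              · exact hX2 r hr
          _ = _ := by
              rw [show -a - 1 = -1 + -a by ring, Real.rpow_add hr0,
                ENNReal.ofReal_mul (by positivity)]
              ring
    _ = _ := by
        rw [lintegral_const_mul _ (by fun_prop), hT, split]
        ring
    _ ≤ _ := le_rfl

/-- Lemma 2(i). One-dimensional weighted Hardy inequality on `[ρ,∞)`
for `s > -1`, `1 ≤ p ≤ q < ∞`. Local absolute continuity of `f` on `[ρ,∞)` is expressed
by `f r = f ρ + ∫_ρ^r f'` with `f'` locally integrable on `[ρ,∞)`. -/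
theorem stmt_1 {N : ℕ} (hN : 1 ≤ N) (s p q ρ : ℝ) (hs : -1 < s) (hp : 1 ≤ p)
    (hpq : p ≤ q) (hρ : 0 < ρ) :
    ∃ C : ℝ, 0 < C ∧
      ∀ f f' : ℝ → ℝ, LocallyIntegrableOn f' (Set.Ici ρ) volume →
        (∀ r, ρ ≤ r → f r = f ρ + ∫ t in ρ..r, f' t) →
        (∫⁻ r in Set.Ioi ρ,
            ENNReal.ofReal ((1 + r) ^ (-(s + 1) * q - N) * r ^ ((N : ℝ) - 1)
              * |f r - f ρ| ^ q)) ^ (1 / q)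
          ≤ ENNReal.ofReal C *
            (∫⁻ r in Set.Ioi ρ,
              ENNReal.ofReal ((1 + r) ^ (-s * p - N) * r ^ ((N : ℝ) - 1)
                * |f' r| ^ p)) ^ (1 / p) := by
  have hp0 : 0 < p := by linarith
  have hq0 : 0 < q := by linarith
  obtain ⟨a, rfl⟩ : ∃ a, s = a - 1 := ⟨s + 1, by ring⟩
  have ha : 0 < a := by linarith
  have hN' : (1 : ℝ) ≤ N := by exact_mod_cast hN
  set e : ℝ := -(a - 1) * p - N with he
  set m : ℝ := (1 + ρ) / ρ with hm
  have hm0 : 0 < m := by positivity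
  set M : ℝ := max 1 (m ^ (-e)) with hM
  have hM0 : 0 < M := lt_of_lt_of_le one_pos (le_max_left _ _)
  have hMe : ∀ r, ρ < r → r ^ e ≤ M * (1 + r) ^ e := by
    intro r hr
    have hr0 : 0 < r := hρ.trans hr
    rcases le_total 0 e with h | h
    · calc r ^ e ≤ (1 + r) ^ e := Real.rpow_le_rpow hr0.le (by linarith) h
        _ ≤ M * (1 + r) ^ e := le_mul_of_one_le_left (by positivity) (le_max_left _ _)
    · have h1 : 1 + r ≤ m * r := by
        rw [hm, div_mul_eq_mul_div, le_div_iff₀ hρ]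
        nlinarith
      have h2 : (m * r) ^ e ≤ (1 + r) ^ e :=
        Real.rpow_le_rpow_of_nonpos (by positivity) h1 h
      calc r ^ e = m ^ (-e) * (m * r) ^ e := by
            rw [Real.mul_rpow hm0.le hr0.le, ← mul_assoc, ← Real.rpow_add hm0]
            simp
        _ ≤ M * (1 + r) ^ e := by
            gcongr
            exact le_max_right _ _
  refine ⟨(1 / a) ^ (1 / q) * ((1 / a) ^ (p - 1) * M) ^ (1 / p), by positivity, ?_⟩
  intro f f' hf' hf
  have hmeas : AEStronglyMeasurable f' (volume.restrict (Set.Ioi ρ)) :=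
    hf'.aestronglyMeasurable.mono_measure (Measure.restrict_mono Set.Ioi_subset_Ici_self le_rfl)
  have hae : AEMeasurable (fun t => ENNReal.ofReal |f' t|) (volume.restrict (Set.Ioi ρ)) :=
    (hmeas.aemeasurable.abs).ennreal_ofReal
  set g := hae.mk _ with hg
  have hgm : Measurable g := hae.measurable_mk
  have hgeq : ∀ᵐ t ∂(volume.restrict (Set.Ioi ρ)), ENNReal.ofReal |f' t| = g t := hae.ae_eq_mk
  set R := ∫⁻ r in Set.Ioi ρ,
              ENNReal.ofReal ((1 + r) ^ e * r ^ ((N : ℝ) - 1) * |f' r| ^ p) with hR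
  have hFr : ∀ r, ρ < r → ENNReal.ofReal |f r - f ρ| ≤ ∫⁻ t in Set.Ioc ρ r, g t := by
    intro r hr
    have : f r - f ρ = ∫ t in Set.Ioc ρ r, f' t := by
      rw [hf r hr.le, intervalIntegral.integral_of_le hr.le]; ring
    rw [this, ← Real.norm_eq_abs]
    have h1 : ENNReal.ofReal ‖∫ t in Set.Ioc ρ r, f' t‖ ≤ ∫⁻ t in Set.Ioc ρ r, ‖f' t‖ₑ := by
      rw [ofReal_norm]
      exact enorm_integral_le_lintegral_enorm _
    refine h1.trans (le_of_eq ?_)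
    apply lintegral_congr_ae
    have := ae_restrict_of_ae_restrict_of_subset
      (Set.Ioc_subset_Ioi_self : Set.Ioc ρ r ⊆ Set.Ioi ρ) hgeq
    filter_upwards [this] with t ht
    rw [← ht, ← ofReal_norm, Real.norm_eq_abs]
  have hL : ∫⁻ r in Set.Ioi ρ,
            ENNReal.ofReal ((1 + r) ^ (-(a - 1 + 1) * q - N) * r ^ ((N : ℝ) - 1)
              * |f r - f ρ| ^ q) ≤
      ∫⁻ r in Set.Ioi ρ, ENNReal.ofReal (r ^ (-a * q - 1)) *
        (∫⁻ t in Set.Ioc ρ r, g t) ^ q := by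
    apply setLIntegral_mono' measurableSet_Ioi
    intro r hr
    have hr0 : 0 < r := hρ.trans hr
    have hr1 : 0 < 1 + r := by linarith
    rw [ENNReal.ofReal_mul (by positivity), ← ENNReal.ofReal_rpow_of_nonneg (abs_nonneg _) hq0.le]
    gcongr
    · calc _ ≤ r ^ (-(a - 1 + 1) * q - N) * r ^ ((N : ℝ) - 1) := by
            gcongr ?_ * _
            refine Real.rpow_le_rpow_of_nonpos hr0 (by linarith) ?_
            have : 0 < a * q := by positivity
            linarith
        _ = _ := by
            rw [← Real.rpow_add hr0]; congr 1; ring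
    · exact hFr r hr
  have hB : ∫⁻ t in Set.Ioi ρ, ENNReal.ofReal (t ^ (-(a - 1) * p - 1)) * g t ^ p
      ≤ ENNReal.ofReal M * R := by
    rw [hR, ← lintegral_const_mul' _ _ ENNReal.ofReal_ne_top]
    apply lintegral_mono_ae
    filter_upwards [hgeq, ae_restrict_mem measurableSet_Ioi] with t ht htρ
    have ht0 : 0 < t := hρ.trans htρ
    have ht1 : 0 < 1 + t := by linarith
    rw [← ht, ENNReal.ofReal_rpow_of_nonneg (abs_nonneg _) hp0.le,
      ← ENNReal.ofReal_mul (by positivity), ← ENNReal.ofReal_mul hM0.le, ← mul_assoc,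
      ← mul_assoc]
    apply ENNReal.ofReal_le_ofReal
    gcongr ?_ * _
    calc t ^ (-(a - 1) * p - 1) = t ^ e * t ^ ((N : ℝ) - 1) := by
          rw [← Real.rpow_add ht0]; congr 1; rw [he]; ring
      _ ≤ _ := by
          gcongr ?_ * _
          exact hMe t htρ
  have H := hL.trans (hardy_core a p q ρ ha hp hpq hρ g hgm)
  have H2 : _ ≤ ENNReal.ofReal (1 / a) *
      (ENNReal.ofReal ((1 / a) ^ (p - 1)) * (ENNReal.ofReal M * R)) ^ (q / p) :=
    H.trans (by gcongr)
  refine (ENNReal.rpow_le_rpow H2 (by positivity : 0 ≤ 1 / q)).trans (le_of_eq ?_)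
  rw [ENNReal.mul_rpow_of_nonneg _ _ (by positivity), ← ENNReal.rpow_mul,
    show q / p * (1 / q) = 1 / p by field_simp, ← mul_assoc (ENNReal.ofReal _) _ R,
    ENNReal.mul_rpow_of_nonneg _ _ (by positivity), ← ENNReal.ofReal_mul (by positivity),
    ENNReal.ofReal_rpow_of_nonneg (by positivity) (by positivity),
    ENNReal.ofReal_rpow_of_nonneg (by positivity) (by positivity), ← mul_assoc,
    ← ENNReal.ofReal_mul (by positivity)]

end
end

section
/- Let N ≥ 1 be an integer, s > -1, 1 ≤ p < ∞ and ρ > 0. Then there is a constant C > 0 such that, for every R ≥ ρ and every locally absolutely continuous function f on [ρ,∞), sup_{r ≥ R} (1+r)^{-(s+1)} |f(r)-f(R)| ≤ C (∫_R^∞ (1+r)^{-sp-N} r^{N-1} |f'(r)|^p dr)^{1/p}, with C independent of R and f. -/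
open MeasureTheory Metric Filter Topology ENNReal

noncomputable section

/-- Pointwise comparison of the weights. -/
lemma aux_pointwise (N : ℕ) (hN : 1 ≤ N) (s p ρ t r a : ℝ) (hs : -1 < s)
    (hρ : 0 < ρ) (ht : ρ ≤ t) (htr : t ≤ r) (ha : 0 ≤ a) :
    (1 + t) ^ s * (a * (1 + t) ^ (-s)) ^ p ≤
      ((1 + r) ^ (s + 1) * ((ρ / (1 + ρ)) ^ ((N : ℝ) - 1))⁻¹) *
        ((1 + t) ^ (-s * p - N) * t ^ ((N : ℝ) - 1) * a ^ p) := by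
  have h1 : 0 < 1 + t := by linarith
  have h0 : 0 < t := by linarith
  have hc : 0 < (ρ / (1 + ρ)) ^ ((N : ℝ) - 1) := by positivity
  have hN' : (0 : ℝ) ≤ (N : ℝ) - 1 := by
    have : (1 : ℝ) ≤ N := by exact_mod_cast hN
    linarith
  have hq : (ρ / (1 + ρ)) ^ ((N : ℝ) - 1) ≤ (t / (1 + t)) ^ ((N : ℝ) - 1) := by
    apply Real.rpow_le_rpow (by positivity) _ hN'
    rw [div_le_div_iff₀ (by linarith) h1]
    nlinarith
  have hr : (1 + t) ^ (s + 1) ≤ (1 + r) ^ (s + 1) :=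
    Real.rpow_le_rpow h1.le (by linarith) (by linarith)
  have hap : 0 ≤ a ^ p := Real.rpow_nonneg ha p
  have e1 : (1 + t) ^ s * (a * (1 + t) ^ (-s)) ^ p
      = (1 + t) ^ (s + 1) * ((1 + t) ^ (-s * p - 1) * a ^ p) := by
    rw [Real.mul_rpow ha (by positivity), ← Real.rpow_mul h1.le]
    have : (1 + t) ^ s * (1 + t) ^ (-s * p) = (1 + t) ^ (s + 1) * (1 + t) ^ (-s * p - 1) := by
      rw [← Real.rpow_add h1, ← Real.rpow_add h1]; congr 1; ring
    linear_combination a ^ p * this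
  have e2 : (1 + t) ^ (-s * p - N) * t ^ ((N : ℝ) - 1)
      = (1 + t) ^ (-s * p - 1) * (t / (1 + t)) ^ ((N : ℝ) - 1) := by
    rw [Real.div_rpow h0.le h1.le]
    have : (1 + t) ^ (-s * p - N) * (1 + t) ^ ((N : ℝ) - 1) = (1 + t) ^ (-s * p - 1) := by
      rw [← Real.rpow_add h1]; congr 1; ring
    rw [← this]
    field_simp
  rw [e1, e2]
  calc (1 + t) ^ (s + 1) * ((1 + t) ^ (-s * p - 1) * a ^ p)
      ≤ (1 + r) ^ (s + 1) * ((1 + t) ^ (-s * p - 1) * a ^ p) := by gcongr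
    _ = (1 + r) ^ (s + 1) * ((ρ / (1 + ρ)) ^ ((N : ℝ) - 1))⁻¹ *
          ((1 + t) ^ (-s * p - 1) * (ρ / (1 + ρ)) ^ ((N : ℝ) - 1) * a ^ p) := by
        field_simp
    _ ≤ _ := by
        have : 0 < 1 + r := by linarith
        gcongr

/-- Mass of the weight. -/
lemma aux_mass (s R r : ℝ) (hs : -1 < s) (hR : 0 < R) (hr : R ≤ r) :
    ∫⁻ t in Set.Ioc R r, ENNReal.ofReal ((1 + t) ^ s) ≤
      ENNReal.ofReal ((1 + r) ^ (s + 1) * (s + 1)⁻¹) := by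
  have hint : IntervalIntegrable (fun t : ℝ => (1 + t) ^ s) volume R r := by
    apply ContinuousOn.intervalIntegrable
    intro t ht
    rw [Set.uIcc_of_le hr] at ht
    have : 1 + t ≠ 0 := by linarith [ht.1]
    exact ((continuousAt_const.add continuousAt_id).rpow_const (Or.inl this)).continuousWithinAt
  rw [← ofReal_integral_eq_lintegral_ofReal
    ((intervalIntegrable_iff_integrableOn_Ioc_of_le hr).1 hint)]
  · apply ENNReal.ofReal_le_ofReal
    rw [← intervalIntegral.integral_of_le hr,
      intervalIntegral.integral_comp_add_left (fun t : ℝ => t ^ s) 1,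
      integral_rpow (Or.inl hs), div_eq_mul_inv]
    have : 0 ≤ (1 + R) ^ (s + 1) := by positivity
    have h2 : 0 < s + 1 := by linarith
    gcongr
    linarith
  · filter_upwards [ae_restrict_mem measurableSet_Ioc] with t ht
    have : 0 < 1 + t := by linarith [ht.1]
    simp only [Pi.zero_apply]
    positivity

theorem stmt_2 {N : ℕ} (hN : 1 ≤ N) (s p ρ : ℝ) (hs : -1 < s) (hp : 1 ≤ p) (hρ : 0 < ρ) :
    ∃ C : ℝ, 0 < C ∧
      ∀ R : ℝ, ρ ≤ R →
      ∀ f f' : ℝ → ℝ, LocallyIntegrableOn f' (Set.Ici ρ) volume →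
        (∀ r, ρ ≤ r → f r = f ρ + ∫ t in ρ..r, f' t) →
        (⨆ r ∈ Set.Ici R, ENNReal.ofReal ((1 + r) ^ (-(s + 1)) * |f r - f R|))
          ≤ ENNReal.ofReal C *
            (∫⁻ r in Set.Ioi R,
              ENNReal.ofReal ((1 + r) ^ (-s * p - N) * r ^ ((N : ℝ) - 1)
                * |f' r| ^ p)) ^ (1 / p) := by
  have hs1 : 0 < s + 1 := by linarith
  have hp0 : 0 < p := by linarith
  set c : ℝ := (ρ / (1 + ρ)) ^ ((N : ℝ) - 1) with hc
  have hc0 : 0 < c := by positivity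
  refine ⟨(c⁻¹) ^ (1 / p) * ((s + 1)⁻¹) ^ (1 - 1 / p), by positivity, ?_⟩
  intro R hR f f' hf' hf
  refine iSup₂_le fun r hr => ?_
  have hr : R ≤ r := hr
  have hR0 : 0 < R := by linarith
  have hr1 : 0 < 1 + r := by linarith
  set I := ∫⁻ r in Set.Ioi R,
              ENNReal.ofReal ((1 + r) ^ (-s * p - N) * r ^ ((N : ℝ) - 1)
                * |f' r| ^ p) with hI
  have hii : ∀ a b, ρ ≤ a → a ≤ b → IntervalIntegrable f' volume a b := by
    intro a b ha hab
    rw [intervalIntegrable_iff_integrableOn_Icc_of_le hab]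
    exact hf'.integrableOn_compact_subset (fun x hx => le_trans ha hx.1) isCompact_Icc
  have hdiff : f r - f R = ∫ t in R..r, f' t := by
    rw [hf r (hR.trans hr), hf R hR,
      ← intervalIntegral.integral_add_adjacent_intervals (hii ρ R le_rfl hR) (hii R r hR hr)]
    ring
  have hfm : AEStronglyMeasurable f' (volume.restrict (Set.Ioc R r)) :=
    ((intervalIntegrable_iff_integrableOn_Ioc_of_le hr).1 (hii R r hR hr)).1
  have h1 : ENNReal.ofReal |f r - f R| ≤ ∫⁻ t in Set.Ioc R r, ENNReal.ofReal |f' t| := by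
    rw [hdiff, intervalIntegral.integral_of_le hr, ← Real.norm_eq_abs, ofReal_norm]
    refine (enorm_integral_le_lintegral_enorm _).trans (le_of_eq ?_)
    simp_rw [← Real.norm_eq_abs, ofReal_norm]
  set w : ℝ → ℝ≥0∞ := fun t => ENNReal.ofReal ((1 + t) ^ s) with hw
  have hwm : Measurable w := by fun_prop
  set μ := (volume.restrict (Set.Ioc R r)).withDensity w with hμ
  set g : ℝ → ℝ := fun t => |f' t| * (1 + t) ^ (-s) with hg
  have hgm : AEStronglyMeasurable g μ := by
    have : AEStronglyMeasurable g (volume.restrict (Set.Ioc R r)) := by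
      apply AEStronglyMeasurable.mul
      · exact hfm.norm
      · exact (by fun_prop : Measurable fun t : ℝ => (1 + t) ^ (-s)).aestronglyMeasurable
    exact this.mono_ac (withDensity_absolutelyContinuous _ _)
  have hwt : ∀ F : ℝ → ℝ≥0∞, ∫⁻ t, F t ∂μ = ∫⁻ t in Set.Ioc R r, w t * F t := by
    intro F
    rw [hμ, lintegral_withDensity_eq_lintegral_mul_non_measurable _ hwm]
    · rfl
    · exact Filter.Eventually.of_forall fun t => ENNReal.ofReal_lt_top
  have h2 : ∫⁻ t in Set.Ioc R r, ENNReal.ofReal |f' t| = eLpNorm g 1 μ := by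
    rw [eLpNorm_one_eq_lintegral_enorm, hwt]
    refine setLIntegral_congr_fun measurableSet_Ioc fun t ht => ?_
    have h1t : 0 < 1 + t := by linarith [ht.1]
    have : 0 ≤ g t := by simp only [hg]; positivity
    simp only [hw]
    rw [← ofReal_norm, Real.norm_of_nonneg this, ← ENNReal.ofReal_mul (by positivity)]
    congr 1
    simp only [hg]
    rw [Real.rpow_neg h1t.le]
    field_simp
  have h3 := eLpNorm_le_eLpNorm_mul_rpow_measure_univ (μ := μ) (f := g) (p := 1)
    (q := ENNReal.ofReal p) (by simpa using hp) hgm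
  have h4 : eLpNorm g (ENNReal.ofReal p) μ ≤
      (ENNReal.ofReal ((1 + r) ^ (s + 1) * c⁻¹) * I) ^ (1 / p) := by
    rw [eLpNorm_eq_lintegral_rpow_enorm_toReal (by simpa using hp0) ENNReal.ofReal_ne_top,
      ENNReal.toReal_ofReal hp0.le, hwt]
    apply ENNReal.rpow_le_rpow _ (by positivity)
    rw [hI, ← lintegral_const_mul' _ _ ENNReal.ofReal_ne_top]
    refine le_trans ?_ (lintegral_mono_set (fun x (hx : x ∈ Set.Ioc R r) => hx.1))
    refine setLIntegral_mono' measurableSet_Ioc fun t ht => ?_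
    have h1t : 0 < 1 + t := by linarith [ht.1]
    have : 0 ≤ g t := by simp only [hg]; positivity
    simp only [hw]
    rw [← ofReal_norm, Real.norm_of_nonneg this,
      ENNReal.ofReal_rpow_of_nonneg this hp0.le, ← ENNReal.ofReal_mul (by positivity),
      ← ENNReal.ofReal_mul (by positivity)]
    apply ENNReal.ofReal_le_ofReal
    exact aux_pointwise N hN s p ρ t r _ hs hρ (by linarith [ht.1]) ht.2 (abs_nonneg _)
  have h5 : μ Set.univ ≤ ENNReal.ofReal ((1 + r) ^ (s + 1) * (s + 1)⁻¹) := by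
    rw [hμ, withDensity_apply _ MeasurableSet.univ, Measure.restrict_univ]
    exact aux_mass s R r hs hR0 hr
  have hp1 : 0 ≤ 1 - 1 / p := by
    rw [sub_nonneg, div_le_one hp0]; exact hp
  have h6 : ENNReal.ofReal |f r - f R| ≤
      (ENNReal.ofReal ((1 + r) ^ (s + 1) * c⁻¹) * I) ^ (1 / p) *
        ENNReal.ofReal ((1 + r) ^ (s + 1) * (s + 1)⁻¹) ^ (1 - 1 / p) := by
    refine h1.trans (h2.le.trans (h3.trans ?_))
    rw [ENNReal.toReal_ofReal hp0.le, ENNReal.toReal_one, div_one]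
    exact mul_le_mul' h4 (ENNReal.rpow_le_rpow h5 hp1)
  rw [ENNReal.ofReal_mul (by positivity)]
  refine (mul_le_mul_right h6 _).trans (le_of_eq ?_)
  rw [ENNReal.mul_rpow_of_nonneg _ _ (by positivity : 0 ≤ 1 / p),
    ENNReal.ofReal_rpow_of_nonneg (by positivity) (by positivity),
    ENNReal.ofReal_rpow_of_nonneg (by positivity) hp1]
  have key : (c⁻¹) ^ (1 / p) * ((s + 1)⁻¹) ^ (1 - 1 / p) =
      (1 + r) ^ (-(s + 1)) * (((1 + r) ^ (s + 1) * c⁻¹) ^ (1 / p) *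
        ((1 + r) ^ (s + 1) * (s + 1)⁻¹) ^ (1 - 1 / p)) := by
    have hA : 0 < (1 + r) ^ (s + 1) := by positivity
    rw [Real.mul_rpow hA.le (by positivity), Real.mul_rpow hA.le (by positivity),
      Real.rpow_neg hr1.le]
    have : ((1 + r) ^ (s + 1)) ^ (1 / p) * ((1 + r) ^ (s + 1)) ^ (1 - 1 / p)
        = (1 + r) ^ (s + 1) := by
      rw [← Real.rpow_add hA, add_sub_cancel, Real.rpow_one]
    have h' : ((1 + r) ^ (s + 1))⁻¹ * (1 + r) ^ (s + 1) = 1 := inv_mul_cancel₀ hA.ne'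
    linear_combination (-(((1 + r) ^ (s + 1))⁻¹ * (c⁻¹) ^ (1 / p) * ((s + 1)⁻¹) ^ (1 - 1 / p))) * this
      - ((c⁻¹) ^ (1 / p) * ((s + 1)⁻¹) ^ (1 - 1 / p)) * h'
  rw [key, ENNReal.ofReal_mul (by positivity), ENNReal.ofReal_mul (by positivity)]
  ring

end
end

section
/- Suppose s > -1 and 1 ≤ p < ∞. Fix ρ > 0 and, for u ∈ D'(ℝ^N) with ∇u ∈ (L^p_s)^N, set c_u := |B_ρ|^{-1} ∫_{B_ρ} u. Then u ∈ L^p_{s+1} and there is a constant C = C(s,p) > 0 independent of u such that ||u - c_u||_{L^p_{s+1}} ≤ C ||\,|∇u|\,||_{L^p_s}. -/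
open MeasureTheory Metric Filter Topology ENNReal

noncomputable section

/-! ### Auxiliary material -/

/-- `[0,∞]`-valued power weight. -/
def Wt (N : ℕ) (r : ℝ) (x : Euc N) : ℝ≥0∞ := ENNReal.ofReal ((1 + ‖x‖) ^ r)

lemma measurable_Wt (N : ℕ) (r : ℝ) : Measurable (Wt N r) := by
  unfold Wt; fun_prop

lemma jensen_lintegral {α : Type*} [MeasurableSpace α] (μ : Measure α) [IsProbabilityMeasure μ]
    (f : α → ℝ≥0∞) (hf : AEMeasurable f μ) {p : ℝ} (hp : 1 ≤ p) :
    (∫⁻ x, f x ∂μ) ^ p ≤ ∫⁻ x, f x ^ p ∂μ := by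
  have hp0 : 0 < p := by linarith
  have h := eLpNorm_le_eLpNorm_of_exponent_le (μ := μ) (f := f) (p := 1) (q := ENNReal.ofReal p)
    (by simpa using ENNReal.ofReal_le_ofReal hp) hf.aestronglyMeasurable
  rw [eLpNorm_one_eq_lintegral_enorm, eLpNorm_eq_lintegral_rpow_enorm_toReal (by simpa using hp0)
    ENNReal.ofReal_ne_top, ENNReal.toReal_ofReal hp0.le] at h
  simp only [enorm_eq_self] at h
  calc _ ≤ _ := ENNReal.rpow_le_rpow h hp0.le
    _ = _ := by rw [← ENNReal.rpow_mul, one_div_mul_cancel hp0.ne', ENNReal.rpow_one]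

lemma lintegral_affine {N : ℕ} (f : Euc N → ℝ≥0∞) (hf : Measurable f) {a : ℝ} (ha : a ≠ 0)
    (v : Euc N) :
    ∫⁻ x, f (a • x + v) = ENNReal.ofReal |(a ^ N)⁻¹| * ∫⁻ x, f x := by
  have h1 : ∫⁻ x, f (a • x + v) = ∫⁻ x, f (x + v) ∂(Measure.map (fun x : Euc N => a • x) volume) := by
    rw [lintegral_map (by fun_prop) (by fun_prop)]
  rw [h1, Measure.map_addHaar_smul _ ha, lintegral_smul_measure, lintegral_add_right_eq_self]
  simp

lemma rpow_compare {A B D r : ℝ} (hA : 0 < A) (hB : 0 < B) (hD : 1 ≤ D) (h1 : A ≤ D * B)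
    (h2 : B ≤ D * A) : A ^ r ≤ D ^ |r| * B ^ r := by
  have hD0 : 0 < D := by linarith
  rcases le_total 0 r with hr | hr
  · rw [abs_of_nonneg hr, ← Real.mul_rpow hD0.le hB.le]
    exact Real.rpow_le_rpow hA.le h1 hr
  · rw [abs_of_nonpos hr]
    have : (D * A) ^ r ≤ B ^ r := Real.rpow_le_rpow_of_nonpos hB h2 hr
    rw [Real.mul_rpow hD0.le hA.le] at this
    calc A ^ r = D ^ (-r) * (D ^ r * A ^ r) := by
          rw [← mul_assoc, ← Real.rpow_add hD0]; simp
      _ ≤ _ := by gcongr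

lemma kernel_good {N : ℕ} {ρ : ℝ} (hρ : 0 < ρ) {t : ℝ} (ht : 0 < t) (ht1 : t ≤ 1)
    (x y : Euc N) (hy : ‖y‖ ≤ ρ) (z : Euc N) (hz : z = t • x + (1 - t) • y)
    (hc : 1 / 2 ≤ t ∨ 2 * ρ ≤ ‖z‖) (r : ℝ) :
    (1 + ‖x‖) ^ r ≤ (4 + 4 * ρ + ρ⁻¹) ^ |r| * ((1 + ‖z‖) / t) ^ r := by
  have hρi : 0 < ρ⁻¹ := by positivity
  have hx0 := norm_nonneg x
  have hz0 := norm_nonneg z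
  have hy0 := norm_nonneg y
  have hyt : ‖(1 - t) • y‖ ≤ ρ := by
    rw [norm_smul, Real.norm_eq_abs, abs_of_nonneg (by linarith)]
    nlinarith
  have htx : ‖t • x‖ = t * ‖x‖ := by rw [norm_smul, Real.norm_eq_abs, abs_of_pos ht]
  have hzx : ‖z‖ ≤ t * ‖x‖ + ρ := by
    rw [hz, ← htx]; exact (norm_add_le _ _).trans (by linarith)
  have hxz : t * ‖x‖ ≤ ‖z‖ + ρ := by
    rw [← htx]
    have : t • x = z - (1 - t) • y := by rw [hz]; abel
    rw [this]; exact (norm_sub_le _ _).trans (by linarith)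
  have htx0 : 0 ≤ t * ‖x‖ := by positivity
  refine rpow_compare (by positivity) (by positivity) (by nlinarith) ?_ ?_
  · rw [mul_div_assoc', le_div_iff₀ ht]
    have h1 : 0 ≤ ρ * ‖z‖ := by positivity
    have h2 : 0 ≤ ρ⁻¹ * ‖z‖ := by positivity
    nlinarith
  · rw [div_le_iff₀ ht]
    have h1 : 0 ≤ ρ * (t * ‖x‖) := by positivity
    have h2 : 0 ≤ ρ⁻¹ * (t * ‖x‖) := by positivity
    rcases hc with hc | hc
    · nlinarith
    · have h3 : ρ ≤ t * ‖x‖ := by linarith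
      have h4 : 1 ≤ ρ⁻¹ * (t * ‖x‖) := by
        rw [← inv_mul_cancel₀ hρ.ne']; gcongr
      nlinarith

lemma kernel_bound (N : ℕ) {s p ρ κ : ℝ} (hp : 1 ≤ p) (hρ : 0 < ρ)
    (hκ : 0 < κ) (hsκ : 0 < s + κ) :
    ∃ C : ℝ, 0 < C ∧ ∀ t : ℝ, 0 < t → t ≤ 1 → ∀ z : Euc N,
      ∫⁻ y in ball (0 : Euc N) ρ, Wt N (-(s * p + N)) (t⁻¹ • (z - (1 - t) • y)) ≤
        ENNReal.ofReal (C * t ^ N * t ^ (-(κ * p))) * Wt N (-(s * p + N)) z := by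
  set b : ℝ := s * p + N with hb
  set r : ℝ := N + (s + κ) * p with hr
  have hp0 : 0 < p := by linarith
  have hI : ∫⁻ x : Euc N, Wt N (-r) x < ⊤ := by
    have : (Module.finrank ℝ (Euc N) : ℝ) < r := by
      simp [hr]; positivity
    exact finite_integral_one_add_norm this
  set I : ℝ := (∫⁻ x : Euc N, Wt N (-r) x).toReal with hIdef
  have hI0 : 0 ≤ I := ENNReal.toReal_nonneg
  set V : ℝ := (volume (ball (0 : Euc N) ρ)).toReal with hVdef
  have hV0 : 0 ≤ V := ENNReal.toReal_nonneg
  have hV : volume (ball (0 : Euc N) ρ) = ENNReal.ofReal V := by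
    rw [hVdef, ENNReal.ofReal_toReal measure_ball_lt_top.ne]
  set D : ℝ := 4 + 4 * ρ + ρ⁻¹ with hD
  have hD0 : 0 < D := by positivity
  set C1 : ℝ := D ^ |-b| * V with hC1
  set C2 : ℝ := (1 + 3 * ρ) ^ (κ * p) * 2 ^ N * I * (1 + 2 * ρ) ^ |(0:ℝ) - b| with hC2
  have hC1' : 0 ≤ C1 := by positivity
  have hC2' : 0 ≤ C2 := by positivity
  refine ⟨C1 + C2 + 1, by positivity, fun t ht ht1 z => ?_⟩
  have hzpow : 0 ≤ (1 + ‖z‖) ^ (-b) := by positivity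
  have htκ : 0 < t ^ (-(κ * p)) := by positivity
  have hzt : ∀ y : Euc N, z = t • (t⁻¹ • (z - (1 - t) • y)) + (1 - t) • y := by
    intro y; rw [smul_smul, mul_inv_cancel₀ ht.ne', one_smul]; abel
  by_cases hc : 1 / 2 ≤ t ∨ 2 * ρ ≤ ‖z‖
  · have hpt : ∀ y ∈ ball (0 : Euc N) ρ, Wt N (-b) (t⁻¹ • (z - (1 - t) • y)) ≤
        ENNReal.ofReal (D ^ |-b| * ((1 + ‖z‖) / t) ^ (-b)) := by
      intro y hy
      exact ENNReal.ofReal_le_ofReal (kernel_good hρ ht ht1 _ y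
        (by simpa using (mem_ball_zero_iff.1 hy).le) z (hzt y) hc (-b))
    calc _ ≤ ∫⁻ y in ball (0 : Euc N) ρ, ENNReal.ofReal (D ^ |-b| * ((1 + ‖z‖) / t) ^ (-b)) :=
          setLIntegral_mono measurable_const hpt
      _ = ENNReal.ofReal (D ^ |-b| * ((1 + ‖z‖) / t) ^ (-b) * V) := by
          rw [setLIntegral_const, hV, ← ENNReal.ofReal_mul (by positivity)]
      _ ≤ ENNReal.ofReal ((C1 + C2 + 1) * t ^ N * t ^ (-(κ * p)) * (1 + ‖z‖) ^ (-b)) := by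
          apply ENNReal.ofReal_le_ofReal
          rw [Real.div_rpow (by positivity) ht.le, Real.rpow_neg ht.le, div_inv_eq_mul]
          have h1 : t ^ b ≤ t ^ N * t ^ (-(κ * p)) := by
            rw [← Real.rpow_natCast, ← Real.rpow_add ht]
            apply Real.rpow_le_rpow_of_exponent_ge ht ht1
            rw [hb]; nlinarith
          calc _ = C1 * t ^ b * (1 + ‖z‖) ^ (-b) := by rw [hC1]; ring
            _ ≤ (C1 + C2 + 1) * (t ^ N * t ^ (-(κ * p))) * (1 + ‖z‖) ^ (-b) := by
              gcongr; linarith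
            _ = _ := by ring
      _ = _ := by rw [Wt, ← ENNReal.ofReal_mul (by positivity)]
  · push Not at hc
    obtain ⟨ht2, hz2⟩ := hc
    have hpt : ∀ y ∈ ball (0 : Euc N) ρ, Wt N (-b) (t⁻¹ • (z - (1 - t) • y)) ≤
        ENNReal.ofReal (((1 + 3 * ρ) / t) ^ (κ * p)) *
          Wt N (-r) ((-((1 - t) / t)) • y + t⁻¹ • z) := by
      intro y hy
      have hx : t⁻¹ • (z - (1 - t) • y) = (-((1 - t) / t)) • y + t⁻¹ • z := by
        rw [smul_sub, smul_smul, neg_smul, div_eq_inv_mul]; abel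
      have hy' : ‖y‖ < ρ := by simpa using hy
      have hxn : ‖t⁻¹ • (z - (1 - t) • y)‖ ≤ 3 * ρ / t := by
        rw [norm_smul, Real.norm_eq_abs, abs_of_pos (by positivity), inv_mul_eq_div]
        gcongr
        refine (norm_sub_le _ _).trans ?_
        rw [norm_smul, Real.norm_eq_abs, abs_of_pos (by linarith)]
        nlinarith [norm_nonneg y]
      rw [← hx]
      set x := t⁻¹ • (z - (1 - t) • y)
      rw [Wt, Wt, ← ENNReal.ofReal_mul (by positivity)]
      apply ENNReal.ofReal_le_ofReal
      have hx0 : 0 < 1 + ‖x‖ := by positivity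
      have : (1 + ‖x‖) ^ (-b) = (1 + ‖x‖) ^ (κ * p) * (1 + ‖x‖) ^ (-r) := by
        rw [← Real.rpow_add hx0]; congr 1; rw [hb, hr]; ring
      rw [this]
      gcongr
      rw [add_div]
      have : 1 ≤ 1 / t := by rw [le_div_iff₀ ht]; linarith
      linarith
    have h1t : 0 < 1 - t := by linarith
    calc _ ≤ ∫⁻ y in ball (0 : Euc N) ρ, ENNReal.ofReal (((1 + 3 * ρ) / t) ^ (κ * p)) *
          Wt N (-r) ((-((1 - t) / t)) • y + t⁻¹ • z) :=
          setLIntegral_mono (((measurable_Wt N (-r)).comp (by fun_prop)).const_mul _) hpt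
      _ ≤ ∫⁻ y : Euc N, ENNReal.ofReal (((1 + 3 * ρ) / t) ^ (κ * p)) *
          Wt N (-r) ((-((1 - t) / t)) • y + t⁻¹ • z) := setLIntegral_le_lintegral _ _
      _ = ENNReal.ofReal (((1 + 3 * ρ) / t) ^ (κ * p) * (|((-((1 - t) / t)) ^ N)⁻¹| * I)) := by
          rw [lintegral_const_mul' _ _ ENNReal.ofReal_ne_top,
            lintegral_affine _ (measurable_Wt N (-r))
              (by rw [neg_ne_zero]; positivity), ENNReal.ofReal_mul (by positivity),
            ENNReal.ofReal_mul (by positivity), hIdef, ENNReal.ofReal_toReal hI.ne]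
      _ ≤ ENNReal.ofReal ((C1 + C2 + 1) * t ^ N * t ^ (-(κ * p)) * (1 + ‖z‖) ^ (-b)) := by
          apply ENNReal.ofReal_le_ofReal
          have e1 : |((-((1 - t) / t)) ^ N)⁻¹| ≤ 2 ^ N * t ^ N := by
            rw [abs_inv, abs_pow, abs_neg, abs_of_pos (by positivity), ← inv_pow, inv_div, ← mul_pow]
            gcongr
            rw [div_le_iff₀ h1t]; nlinarith
          have e2 : ((1 + 3 * ρ) / t) ^ (κ * p) = (1 + 3 * ρ) ^ (κ * p) * t ^ (-(κ * p)) := by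
            rw [Real.div_rpow (by positivity) ht.le, Real.rpow_neg ht.le]; rfl
          have e3 : 1 ≤ (1 + 2 * ρ) ^ |(0:ℝ) - b| * (1 + ‖z‖) ^ (-b) := by
            have := rpow_compare (A := 1) (B := 1 + ‖z‖) (D := 1 + 2 * ρ) (r := 0 - b) one_pos
              (by positivity) (by linarith) (by nlinarith [norm_nonneg z]) (by linarith)
            simpa using this
          rw [e2]
          calc _ ≤ (1 + 3 * ρ) ^ (κ * p) * t ^ (-(κ * p)) * ((2 ^ N * t ^ N) * I) := by gcongr
            _ = (1 + 3 * ρ) ^ (κ * p) * t ^ (-(κ * p)) * ((2 ^ N * t ^ N) * I) * 1 := by ring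
            _ ≤ (1 + 3 * ρ) ^ (κ * p) * t ^ (-(κ * p)) * ((2 ^ N * t ^ N) * I) *
                ((1 + 2 * ρ) ^ |(0:ℝ) - b| * (1 + ‖z‖) ^ (-b)) := by gcongr
            _ = C2 * t ^ N * t ^ (-(κ * p)) * (1 + ‖z‖) ^ (-b) := by rw [hC2]; ring
            _ ≤ _ := by gcongr; linarith
      _ = _ := by rw [Wt, ← ENNReal.ofReal_mul (by positivity)]

lemma slice_bound (N : ℕ) {s p ρ κ : ℝ} (hp : 1 ≤ p) (hρ : 0 < ρ)
    (hκ : 0 < κ) (hsκ : 0 < s + κ) :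
    ∃ C : ℝ, 0 < C ∧ ∀ G : Euc N → ℝ≥0∞, Measurable G → ∀ t : ℝ, 0 < t → t ≤ 1 →
      ∫⁻ x : Euc N, ∫⁻ y in ball (0 : Euc N) ρ, Wt N (-(s * p + N)) x * G (y + t • (x - y)) ≤
        ENNReal.ofReal (C * t ^ (-(κ * p))) * ∫⁻ z, Wt N (-(s * p + N)) z * G z := by
  obtain ⟨C, hC, hK⟩ := kernel_bound N hp hρ hκ hsκ
  refine ⟨C, hC, fun G hG t ht ht1 => ?_⟩
  set b : ℝ := s * p + N with hb
  have hW := measurable_Wt N (-b)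
  rw [lintegral_lintegral_swap]
  swap
  · apply Measurable.aemeasurable
    unfold Function.uncurry
    exact (hW.comp measurable_fst).mul (hG.comp (by fun_prop))
  have h1 : ∀ y : Euc N, ∫⁻ x : Euc N, Wt N (-b) x * G (y + t • (x - y)) =
      ENNReal.ofReal (t ^ N)⁻¹ * ∫⁻ z, Wt N (-b) (t⁻¹ • (z - (1 - t) • y)) * G z := by
    intro y
    have := lintegral_affine (fun z => Wt N (-b) (t⁻¹ • (z - (1 - t) • y)) * G z)
      ((hW.comp (by fun_prop)).mul hG) ht.ne' ((1 - t) • y)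
    rw [abs_of_pos (by positivity)] at this
    rw [← this]
    refine lintegral_congr fun x => ?_
    have e1 : t⁻¹ • (t • x + (1 - t) • y - (1 - t) • y) = x := by
      rw [add_sub_cancel_right, smul_smul, inv_mul_cancel₀ ht.ne', one_smul]
    have e2 : t • x + (1 - t) • y = y + t • (x - y) := by
      rw [smul_sub, sub_smul, one_smul]; abel
    rw [e1, e2]
  simp_rw [h1]
  rw [lintegral_const_mul' _ _ ENNReal.ofReal_ne_top, lintegral_lintegral_swap]
  swap
  · apply Measurable.aemeasurable
    unfold Function.uncurry
    exact (hW.comp (by fun_prop)).mul (hG.comp (by fun_prop))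
  have h2 : ∀ z : Euc N, ∫⁻ y in ball (0 : Euc N) ρ, Wt N (-b) (t⁻¹ • (z - (1 - t) • y)) * G z ≤
      ENNReal.ofReal (C * t ^ N * t ^ (-(κ * p))) * (Wt N (-b) z * G z) := by
    intro z
    have hm : Measurable fun y : Euc N => Wt N (-b) (t⁻¹ • (z - (1 - t) • y)) :=
      hW.comp (by fun_prop)
    rw [lintegral_mul_const _ hm, ← mul_assoc]
    gcongr
    exact hK t ht ht1 z
  calc _ ≤ ENNReal.ofReal (t ^ N)⁻¹ *
        ∫⁻ z, ENNReal.ofReal (C * t ^ N * t ^ (-(κ * p))) * (Wt N (-b) z * G z) := by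
        gcongr with z; exact h2 z
    _ = _ := by
        rw [lintegral_const_mul' _ _ ENNReal.ofReal_ne_top, ← mul_assoc,
          ← ENNReal.ofReal_mul (by positivity)]
        congr 2
        field_simp

lemma path_bound {N : ℕ} {p : ℝ} (hp : 1 ≤ p) (u : Euc N → ℝ) (hu : ContDiff ℝ 1 u) (k : ℕ)
    (x y : Euc N) :
    ‖u x - u y‖ₑ ^ p ≤ ∫⁻ τ in Set.Ioc (0 : ℝ) 1,
      (ENNReal.ofReal (((k + 1 : ℕ) : ℝ) * τ ^ k * ‖x - y‖) *
        ‖fderiv ℝ u (y + τ ^ (k + 1) • (x - y))‖ₑ) ^ p := by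
  have hp0 : 0 ≤ p := by linarith
  have hdu : Continuous (fderiv ℝ u) := hu.continuous_fderiv (by norm_num)
  have hder : ∀ τ : ℝ, HasDerivAt (fun τ : ℝ => u (y + τ ^ (k + 1) • (x - y)))
      (fderiv ℝ u (y + τ ^ (k + 1) • (x - y)) ((((k + 1 : ℕ) : ℝ) * τ ^ k) • (x - y))) τ := by
    intro τ
    have h1 : HasDerivAt (fun τ : ℝ => y + τ ^ (k + 1) • (x - y))
        ((((k + 1 : ℕ) : ℝ) * τ ^ k) • (x - y)) τ := by
      have := ((hasDerivAt_pow (k + 1) τ).smul_const (x - y)).const_add y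
      simpa using this
    exact ((hu.differentiable (by norm_num) _).hasFDerivAt).comp_hasDerivAt τ h1
  have hcont : Continuous fun τ : ℝ =>
      fderiv ℝ u (y + τ ^ (k + 1) • (x - y)) ((((k + 1 : ℕ) : ℝ) * τ ^ k) • (x - y)) := by
    fun_prop
  have hftc := intervalIntegral.integral_eq_sub_of_hasDerivAt (a := 0) (b := 1)
    (fun τ _ => hder τ) (hcont.intervalIntegrable 0 1)
  have hftc' : u x - u y = ∫ τ in (0 : ℝ)..1,
      fderiv ℝ u (y + τ ^ (k + 1) • (x - y)) ((((k + 1 : ℕ) : ℝ) * τ ^ k) • (x - y)) := by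
    rw [hftc]; simp
  rw [hftc', intervalIntegral.integral_of_le zero_le_one]
  have : IsProbabilityMeasure (volume.restrict (Set.Ioc (0 : ℝ) 1)) := ⟨by simp⟩
  have hle : ∀ τ ∈ Set.Ioc (0 : ℝ) 1,
      ‖fderiv ℝ u (y + τ ^ (k + 1) • (x - y)) ((((k + 1 : ℕ) : ℝ) * τ ^ k) • (x - y))‖ₑ ≤
      ENNReal.ofReal (((k + 1 : ℕ) : ℝ) * τ ^ k * ‖x - y‖) *
        ‖fderiv ℝ u (y + τ ^ (k + 1) • (x - y))‖ₑ := by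
    intro τ hτ
    refine (ContinuousLinearMap.le_opENorm _ _).trans ?_
    rw [mul_comm]
    gcongr
    rw [← ofReal_norm, norm_smul, Real.norm_eq_abs, abs_of_nonneg]
    have := hτ.1
    positivity
  calc _ ≤ (∫⁻ τ in Set.Ioc (0 : ℝ) 1,
        ‖fderiv ℝ u (y + τ ^ (k + 1) • (x - y)) ((((k + 1 : ℕ) : ℝ) * τ ^ k) • (x - y))‖ₑ) ^ p := by
        gcongr; exact enorm_integral_le_lintegral_enorm _
    _ ≤ ∫⁻ τ in Set.Ioc (0 : ℝ) 1,
        ‖fderiv ℝ u (y + τ ^ (k + 1) • (x - y)) ((((k + 1 : ℕ) : ℝ) * τ ^ k) • (x - y))‖ₑ ^ p :=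
        jensen_lintegral _ _ hcont.enorm.measurable.aemeasurable hp
    _ ≤ _ := by
        refine setLIntegral_mono' measurableSet_Ioc fun τ hτ => ?_
        exact ENNReal.rpow_le_rpow (hle τ hτ) hp0

lemma smooth_bound (N : ℕ) {s p ρ : ℝ} (hs : -1 < s) (hp : 1 ≤ p) (hρ : 0 < ρ) :
    ∃ C : ℝ, 0 < C ∧ ∀ u : Euc N → ℝ, ContDiff ℝ 1 u →
      ∫⁻ x : Euc N, ∫⁻ y in ball (0 : Euc N) ρ,
          Wt N (-((s + 1) * p + N)) x * ‖u x - u y‖ₑ ^ p ≤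
        ENNReal.ofReal C * ∫⁻ z, Wt N (-(s * p + N)) z * ‖fderiv ℝ u z‖ₑ ^ p := by
  have hp0 : 0 < p := by linarith
  obtain ⟨κ, hκ1, hκ2⟩ := exists_between (show max 0 (-s) < 1 by
    rw [max_lt_iff]; constructor <;> linarith)
  have hκ : 0 < κ := (le_max_left _ _).trans_lt hκ1
  have hsκ : 0 < s + κ := by have := (le_max_right _ _).trans_lt hκ1; linarith
  obtain ⟨k, hk⟩ := exists_nat_ge (κ / (1 - κ))
  have hk' : ((k : ℝ) + 1) * κ ≤ k := by
    rw [div_le_iff₀ (by linarith)] at hk; linarith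
  obtain ⟨C, hC, hS⟩ := slice_bound N hp hρ hκ hsκ
  set A : ℝ := ((1 + ρ) * ((k + 1 : ℕ) : ℝ)) ^ p with hA
  have hA0 : 0 < A := by positivity
  refine ⟨A * C, by positivity, fun u hu => ?_⟩
  set b : ℝ := s * p + N with hb
  have hW := measurable_Wt N (-b)
  have hdu : Continuous (fderiv ℝ u) := hu.continuous_fderiv (by norm_num)
  set G : Euc N → ℝ≥0∞ := fun z => ‖fderiv ℝ u z‖ₑ ^ p with hGdef
  have hG : Measurable G := (hdu.enorm.measurable).pow_const p
  -- pointwise bound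
  have hpt : ∀ x : Euc N, ∀ y ∈ ball (0 : Euc N) ρ,
      Wt N (-((s + 1) * p + N)) x * ‖u x - u y‖ₑ ^ p ≤
      ∫⁻ τ in Set.Ioc (0 : ℝ) 1, ENNReal.ofReal (A * (τ ^ k) ^ p) *
        (Wt N (-b) x * G (y + τ ^ (k + 1) • (x - y))) := by
    intro x y hy
    have hy' : ‖y‖ < ρ := by simpa using hy
    calc _ ≤ Wt N (-((s + 1) * p + N)) x * ∫⁻ τ in Set.Ioc (0 : ℝ) 1,
          (ENNReal.ofReal (((k + 1 : ℕ) : ℝ) * τ ^ k * ‖x - y‖) *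
          ‖fderiv ℝ u (y + τ ^ (k + 1) • (x - y))‖ₑ) ^ p := by
          gcongr; exact path_bound hp u hu k x y
      _ = ∫⁻ τ in Set.Ioc (0 : ℝ) 1, Wt N (-((s + 1) * p + N)) x *
          (ENNReal.ofReal (((k + 1 : ℕ) : ℝ) * τ ^ k * ‖x - y‖) *
          ‖fderiv ℝ u (y + τ ^ (k + 1) • (x - y))‖ₑ) ^ p := by
          rw [lintegral_const_mul' _ _ (by rw [Wt]; exact ENNReal.ofReal_ne_top)]
      _ ≤ _ := by
          refine setLIntegral_mono' measurableSet_Ioc fun τ hτ => ?_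
          have hτ0 := hτ.1
          rw [ENNReal.mul_rpow_of_nonneg _ _ hp0.le, ← mul_assoc, ← mul_assoc]
          refine mul_le_mul_left ?_ _
          rw [Wt, Wt, ENNReal.ofReal_rpow_of_nonneg (by positivity) hp0.le,
            ← ENNReal.ofReal_mul (by positivity), ← ENNReal.ofReal_mul (by positivity)]
          apply ENNReal.ofReal_le_ofReal
          have hx0 : 0 < 1 + ‖x‖ := by positivity
          have hxy : ‖x - y‖ ≤ (1 + ρ) * (1 + ‖x‖) := by
            refine (norm_sub_le _ _).trans ?_
            nlinarith [norm_nonneg x, mul_nonneg hρ.le (norm_nonneg x)]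
          calc (1 + ‖x‖) ^ (-((s + 1) * p + N)) * (((k + 1 : ℕ) : ℝ) * τ ^ k * ‖x - y‖) ^ p
              ≤ (1 + ‖x‖) ^ (-((s + 1) * p + N)) *
                (((k + 1 : ℕ) : ℝ) * τ ^ k * ((1 + ρ) * (1 + ‖x‖))) ^ p := by gcongr
            _ = (1 + ‖x‖) ^ (-((s + 1) * p + N)) *
                (A * (τ ^ k) ^ p * (1 + ‖x‖) ^ p) := by
                rw [hA, ← Real.mul_rpow (by positivity) (by positivity),
                  ← Real.mul_rpow (by positivity) (by positivity)]
                congr 2; ring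
            _ = A * (τ ^ k) ^ p * ((1 + ‖x‖) ^ (-((s + 1) * p + N)) * (1 + ‖x‖) ^ p) := by ring
            _ = _ := by
                rw [← Real.rpow_add hx0]; congr 2; rw [hb]; ring
  have hmeas : Measurable fun q : Euc N × Euc N × ℝ => ENNReal.ofReal (A * (q.2.2 ^ k) ^ p) *
        (Wt N (-b) q.1 * G (q.2.1 + q.2.2 ^ (k + 1) • (q.1 - q.2.1))) := by
    refine Measurable.mul (by fun_prop) ((hW.comp measurable_fst).mul (hG.comp (by fun_prop)))
  calc _ ≤ ∫⁻ x : Euc N, ∫⁻ y in ball (0 : Euc N) ρ, ∫⁻ τ in Set.Ioc (0 : ℝ) 1,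
        ENNReal.ofReal (A * (τ ^ k) ^ p) * (Wt N (-b) x * G (y + τ ^ (k + 1) • (x - y))) :=
        lintegral_mono fun x => setLIntegral_mono' measurableSet_ball (hpt x)
    _ = ∫⁻ x : Euc N, ∫⁻ τ in Set.Ioc (0 : ℝ) 1, ∫⁻ y in ball (0 : Euc N) ρ,
        ENNReal.ofReal (A * (τ ^ k) ^ p) * (Wt N (-b) x * G (y + τ ^ (k + 1) • (x - y))) := by
        refine lintegral_congr fun x => ?_
        rw [lintegral_lintegral_swap]
        apply Measurable.aemeasurable
        exact hmeas.comp (f := fun r : Euc N × ℝ => (x, r.1, r.2)) (by fun_prop)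
    _ = ∫⁻ τ in Set.Ioc (0 : ℝ) 1, ∫⁻ x : Euc N, ∫⁻ y in ball (0 : Euc N) ρ,
        ENNReal.ofReal (A * (τ ^ k) ^ p) * (Wt N (-b) x * G (y + τ ^ (k + 1) • (x - y))) := by
        rw [lintegral_lintegral_swap]
        apply Measurable.aemeasurable
        exact Measurable.lintegral_prod_right' (hmeas.comp
          (f := fun r : (Euc N × ℝ) × Euc N => (r.1.1, r.2, r.1.2)) (by fun_prop))
    _ ≤ ∫⁻ τ in Set.Ioc (0 : ℝ) 1, ENNReal.ofReal (A * C) * ∫⁻ z, Wt N (-b) z * G z := by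
        refine setLIntegral_mono' measurableSet_Ioc fun τ hτ => ?_
        have hτ0 := hτ.1
        simp_rw [lintegral_const_mul' _ _ ENNReal.ofReal_ne_top]
        calc _ ≤ ENNReal.ofReal (A * (τ ^ k) ^ p) *
              (ENNReal.ofReal (C * (τ ^ (k + 1)) ^ (-(κ * p))) * ∫⁻ z, Wt N (-b) z * G z) := by
              gcongr
              exact hS G hG (τ ^ (k + 1)) (by positivity) (pow_le_one₀ hτ0.le hτ.2)
          _ ≤ _ := by
              rw [← mul_assoc, ← ENNReal.ofReal_mul (by positivity)]
              refine mul_le_mul_left (ENNReal.ofReal_le_ofReal ?_) _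
              have : (τ ^ k) ^ p * (τ ^ (k + 1)) ^ (-(κ * p)) ≤ 1 := by
                rw [← Real.rpow_natCast, ← Real.rpow_natCast, ← Real.rpow_mul hτ0.le,
                  ← Real.rpow_mul hτ0.le, ← Real.rpow_add hτ0]
                apply Real.rpow_le_one hτ0.le hτ.2
                push_cast
                nlinarith
              calc _ = A * C * ((τ ^ k) ^ p * (τ ^ (k + 1)) ^ (-(κ * p))) := by ring
                _ ≤ A * C * 1 := by gcongr
                _ = _ := by ring
    _ = _ := by simp [hGdef]

lemma mollify_weight (N : ℕ) {p b : ℝ} (hp : 1 ≤ p) (φ : ContDiffBump (0 : Euc N))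
    (hφ : φ.rOut ≤ 1) (h : Euc N → ℝ≥0∞) (hh : AEMeasurable h volume) :
    ∫⁻ z : Euc N, Wt N b z * (∫⁻ y, ENNReal.ofReal (φ.normed volume (z - y)) * h y) ^ p ≤
      ENNReal.ofReal (2 ^ |b|) * ∫⁻ y, Wt N b y * h y ^ p := by
  wlog hm : Measurable h generalizing h
  · have e := hh.ae_eq_mk
    have h1 : ∀ z : Euc N, ∫⁻ y, ENNReal.ofReal (φ.normed volume (z - y)) * h y =
        ∫⁻ y, ENNReal.ofReal (φ.normed volume (z - y)) * hh.mk h y := fun z =>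
      lintegral_congr_ae (by filter_upwards [e] with y hy; rw [hy])
    have h2 : ∫⁻ y, Wt N b y * h y ^ p = ∫⁻ y, Wt N b y * hh.mk h y ^ p :=
      lintegral_congr_ae (by filter_upwards [e] with y hy; rw [hy])
    simp_rw [h1, h2]
    exact this _ hh.measurable_mk.aemeasurable hh.measurable_mk
  have hψ : Continuous (φ.normed (volume : Measure (Euc N))) := φ.continuous_normed
  have hψ1 : ∫⁻ y, ENNReal.ofReal (φ.normed (volume : Measure (Euc N)) y) = 1 := by
    rw [← ofReal_integral_eq_lintegral_ofReal φ.integrable_normed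
      (Eventually.of_forall φ.nonneg_normed), φ.integral_normed, ENNReal.ofReal_one]
  have hW := measurable_Wt N b
  have hpt : ∀ z : Euc N, Wt N b z * (∫⁻ y, ENNReal.ofReal (φ.normed volume (z - y)) * h y) ^ p ≤
      ∫⁻ y, ENNReal.ofReal (2 ^ |b|) *
        (ENNReal.ofReal (φ.normed volume (z - y)) * (Wt N b y * h y ^ p)) := by
    intro z
    have hd : Measurable fun y => ENNReal.ofReal (φ.normed (volume : Measure (Euc N)) (z - y)) := by
      fun_prop
    set μ : Measure (Euc N) := volume.withDensity
      (fun y => ENNReal.ofReal (φ.normed (volume : Measure (Euc N)) (z - y))) with hμ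
    have hprob : IsProbabilityMeasure μ := ⟨by
      rw [hμ, withDensity_apply _ MeasurableSet.univ, Measure.restrict_univ]
      rw [lintegral_sub_left_eq_self
        (fun y => ENNReal.ofReal (φ.normed (volume : Measure (Euc N)) y)) z, hψ1]⟩
    have hJ := jensen_lintegral μ h hm.aemeasurable hp
    rw [hμ, lintegral_withDensity_eq_lintegral_mul _ hd hm,
      lintegral_withDensity_eq_lintegral_mul _ hd (hm.pow_const p)] at hJ
    simp only [Pi.mul_apply] at hJ
    calc _ ≤ Wt N b z * ∫⁻ y, ENNReal.ofReal (φ.normed volume (z - y)) * h y ^ p := by gcongr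
      _ = ∫⁻ y, Wt N b z * (ENNReal.ofReal (φ.normed volume (z - y)) * h y ^ p) := by
        rw [lintegral_const_mul' _ _ (by rw [Wt]; exact ENNReal.ofReal_ne_top)]
      _ ≤ _ := by
        refine lintegral_mono fun y => ?_
        by_cases hzy : z - y ∈ ball (0 : Euc N) φ.rOut
        · have hzy' : ‖z - y‖ ≤ 1 := ((mem_ball_zero_iff.1 hzy).le).trans hφ
          have hw : Wt N b z ≤ ENNReal.ofReal (2 ^ |b|) * Wt N b y := by
            rw [Wt, Wt, ← ENNReal.ofReal_mul (by positivity)]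
            apply ENNReal.ofReal_le_ofReal
            have a1 := norm_sub_norm_le z y
            have a2 := norm_sub_norm_le y z
            rw [norm_sub_rev] at a2
            have := norm_nonneg z
            have := norm_nonneg y
            exact rpow_compare (by positivity) (by positivity) (by norm_num) (by linarith)
              (by linarith)
          calc _ ≤ (ENNReal.ofReal (2 ^ |b|) * Wt N b y) *
                (ENNReal.ofReal (φ.normed volume (z - y)) * h y ^ p) := by gcongr
            _ = _ := by ring
        · have : φ.normed (volume : Measure (Euc N)) (z - y) = 0 := by
            rw [← φ.support_normed_eq (μ := volume)] at hzy
            simpa using hzy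
          simp [this]
  calc _ ≤ _ := lintegral_mono hpt
    _ = ENNReal.ofReal (2 ^ |b|) * ∫⁻ z : Euc N, ∫⁻ y,
        ENNReal.ofReal (φ.normed volume (z - y)) * (Wt N b y * h y ^ p) := by
        simp_rw [lintegral_const_mul' _ _ ENNReal.ofReal_ne_top]
    _ = ENNReal.ofReal (2 ^ |b|) * ∫⁻ y : Euc N, ∫⁻ z,
        ENNReal.ofReal (φ.normed volume (z - y)) * (Wt N b y * h y ^ p) := by
        rw [lintegral_lintegral_swap]
        apply Measurable.aemeasurable
        unfold Function.uncurry
        refine Measurable.mul (by fun_prop) ?_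
        exact (hW.comp measurable_snd).mul ((hm.comp measurable_snd).pow_const p)
    _ = _ := by
        congr 1
        refine lintegral_congr fun y => ?_
        rw [lintegral_mul_const _ (by fun_prop),
          lintegral_sub_right_eq_self
            (fun z => ENNReal.ofReal (φ.normed (volume : Measure (Euc N)) z)) y, hψ1, one_mul]

lemma gradNorm1_meas {N : ℕ} {g : Fin N → Euc N → ℝ}
    (hg : ∀ i, AEStronglyMeasurable (g i) volume) :
    AEStronglyMeasurable (gradNorm1 g) volume := by
  unfold gradNorm1
  apply AEMeasurable.aestronglyMeasurable
  refine Measurable.comp_aemeasurable Real.continuous_sqrt.measurable ?_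
  exact Finset.aemeasurable_fun_sum (μ := (volume : Measure (Euc N))) Finset.univ
    (f := fun i x => g i x ^ 2) (fun i _ => (hg i).aemeasurable.pow_const 2)

lemma mollify_fderiv {N : ℕ} {u : Euc N → ℝ} {g : Fin N → Euc N → ℝ}
    (hu : LocallyIntegrable u volume)
    (hg : ∀ i, IsWeakPartialDeriv i u (g i)) (φ : ContDiffBump (0 : Euc N)) (z : Euc N) :
    ‖fderiv ℝ (convolution (φ.normed volume) u (ContinuousLinearMap.lsmul ℝ ℝ) volume) z‖ₑ ≤
      ∫⁻ y, ENNReal.ofReal (φ.normed volume (z - y)) * ‖gradNorm1 g y‖ₑ := by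
  set ψ : Euc N → ℝ := φ.normed volume with hψdef
  have hψs : ContDiff ℝ (⊤ : ℕ∞) ψ := φ.contDiff_normed
  have hψc : HasCompactSupport ψ := φ.hasCompactSupport_normed
  have hψ1 : ContDiff ℝ 1 ψ := φ.contDiff_normed (n := 1)
  have hψd : ∀ x, HasFDerivAt ψ (fderiv ℝ ψ x) x := fun x =>
    (hψ1.differentiable (by norm_num) x).hasFDerivAt
  set χ : Euc N → ℝ := fun y => ψ (z - y) with hχ
  have hχs : ContDiff ℝ (⊤ : ℕ∞) χ := hψs.comp (contDiff_const.sub contDiff_id)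
  have hχc : HasCompactSupport χ := hψc.comp_homeomorph (Homeomorph.subLeft z)
  have hχd : ∀ y, fderiv ℝ χ y = -fderiv ℝ ψ (z - y) := by
    intro y
    have h1 : HasFDerivAt (fun y : Euc N => z - y) (-(ContinuousLinearMap.id ℝ (Euc N))) y :=
      (hasFDerivAt_id y).const_sub z
    have := ((hψd (z - y)).comp y h1).fderiv
    rw [hχ]
    refine this.trans ?_
    ext w; simp
  have hder := (hψc.hasFDerivAt_convolution_left (ContinuousLinearMap.lsmul ℝ ℝ) hψ1 hu z).fderiv
  have hint : ∀ i, Integrable (fun y => g i y * χ y) volume := fun i => by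
    have := (hg i).2.1.integrable_smul_right_of_hasCompactSupport hχs.continuous hχc
    simpa [smul_eq_mul, mul_comm] using this
  have hei : ∀ i, fderiv ℝ (convolution ψ u (ContinuousLinearMap.lsmul ℝ ℝ) volume) z
      (EuclideanSpace.single i 1) = ∫ y, g i y * χ y := by
    intro i
    rw [hder, convolution_eq_swap, ContinuousLinearMap.integral_apply]
    · have := (hg i).2.2 χ hχs hχc
      simp only [pderivList, hχd] at this
      simp only [List.length_singleton, pow_one, neg_one_mul, neg_apply,
        mul_neg, integral_neg, neg_inj] at this
      rw [← this]
      refine integral_congr_ae (Eventually.of_forall fun y => ?_)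
      simp [mul_comm]
    · have := (hψc.fderiv ℝ).convolutionExists_left
        ((ContinuousLinearMap.lsmul ℝ ℝ : ℝ →L[ℝ] ℝ →L[ℝ] ℝ).precompL (Euc N))
        (hψ1.continuous_fderiv (by norm_num)) hu z
      exact this.integrable_swap
  have hw : ∀ w : Euc N, fderiv ℝ (convolution ψ u (ContinuousLinearMap.lsmul ℝ ℝ) volume) z w =
      ∫ y, (∑ i, w i * g i y) * χ y := by
    intro w
    have hwe : w = ∑ i, w i • EuclideanSpace.single i (1 : ℝ) := by
      ext j; simp [Pi.single_apply]
    conv_lhs => rw [hwe]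
    rw [map_sum]
    simp_rw [map_smul, hei, Finset.sum_mul, mul_assoc]
    rw [integral_finsetSum _ (fun i _ => (hint i).const_mul _)]
    simp_rw [integral_const_mul, smul_eq_mul]
  set c := ∫⁻ y, ENNReal.ofReal (ψ (z - y)) * ‖gradNorm1 g y‖ₑ with hc
  have hbound : ∀ w : Euc N,
      ‖fderiv ℝ (convolution ψ u (ContinuousLinearMap.lsmul ℝ ℝ) volume) z w‖ₑ ≤ ‖w‖ₑ * c := by
    intro w
    rw [hw, hc, ← lintegral_const_mul' _ _ (by simp)]
    refine (enorm_integral_le_lintegral_enorm _).trans (lintegral_mono fun y => ?_)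
    have hχ0 : 0 ≤ χ y := φ.nonneg_normed _
    have hgr : 0 ≤ gradNorm1 g y := Real.sqrt_nonneg _
    rw [← ofReal_norm, ← ofReal_norm, ← ofReal_norm, ← ENNReal.ofReal_mul hχ0,
      ← ENNReal.ofReal_mul (norm_nonneg _)]
    apply ENNReal.ofReal_le_ofReal
    have hCS : |∑ i, w i * g i y| ≤ ‖w‖ * gradNorm1 g y := by
      rw [EuclideanSpace.norm_eq, gradNorm1, ← Real.sqrt_mul (by positivity)]
      apply Real.abs_le_sqrt
      simpa using Finset.sum_mul_sq_le_sq_mul_sq Finset.univ (fun i => w i) (fun i => g i y)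
    rw [norm_mul, Real.norm_eq_abs, Real.norm_of_nonneg hχ0, Real.norm_of_nonneg hgr]
    calc _ ≤ (‖w‖ * gradNorm1 g y) * χ y := by gcongr
      _ = _ := by simp only [hχ]; ring
  by_cases hct : c = ⊤
  · rw [hct]; exact le_top
  rw [← ofReal_norm, ENNReal.ofReal_le_iff_le_toReal hct]
  refine ContinuousLinearMap.opNorm_le_bound _ ENNReal.toReal_nonneg fun w => ?_
  have := ENNReal.toReal_mono (ENNReal.mul_ne_top (by simp) hct) (hbound w)
  rw [ENNReal.toReal_mul] at this
  simpa [mul_comm] using this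

lemma fatou_bound {N : ℕ} {p ρ a : ℝ} {B : ℝ≥0∞} (u : Euc N → ℝ) (v : ℕ → Euc N → ℝ)
    (hvc : ∀ n, Continuous (v n))
    (hconv : ∀ᵐ x : Euc N, Tendsto (fun n => v n x) atTop (𝓝 (u x)))
    (hn : ∀ n, ∫⁻ x : Euc N, ∫⁻ y in ball (0 : Euc N) ρ,
      Wt N a x * ‖v n x - v n y‖ₑ ^ p ≤ B) :
    ∫⁻ x : Euc N, ∫⁻ y in ball (0 : Euc N) ρ, Wt N a x * ‖u x - u y‖ₑ ^ p ≤ B := by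
  have hF : ∀ n, Measurable fun q : Euc N × Euc N => Wt N a q.1 * ‖v n q.1 - v n q.2‖ₑ ^ p := by
    intro n
    refine ((measurable_Wt N a).comp measurable_fst).mul (Measurable.pow_const ?_ p)
    have := hvc n
    fun_prop
  have hinner : ∀ᵐ x : Euc N, ∫⁻ y in ball (0 : Euc N) ρ, Wt N a x * ‖u x - u y‖ₑ ^ p ≤
      liminf (fun n => ∫⁻ y in ball (0 : Euc N) ρ, Wt N a x * ‖v n x - v n y‖ₑ ^ p) atTop := by
    filter_upwards [hconv] with x hx
    calc _ = ∫⁻ y in ball (0 : Euc N) ρ,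
          liminf (fun n => Wt N a x * ‖v n x - v n y‖ₑ ^ p) atTop := by
          refine lintegral_congr_ae ?_
          filter_upwards [ae_restrict_of_ae hconv] with y hy
          refine (Tendsto.liminf_eq ?_).symm
          refine ENNReal.Tendsto.const_mul ?_ (Or.inr (by rw [Wt]; exact ENNReal.ofReal_ne_top))
          have hxy : Tendsto (fun n => ‖v n x - v n y‖ₑ) atTop (𝓝 ‖u x - u y‖ₑ) :=
            (continuous_enorm.tendsto (u x - u y)).comp (hx.sub hy)
          exact hxy.ennrpow_const p
      _ ≤ liminf (fun n => ∫⁻ y in ball (0 : Euc N) ρ,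
          Wt N a x * ‖v n x - v n y‖ₑ ^ p) atTop := by
          refine lintegral_liminf_le (f := fun n y => Wt N a x * ‖v n x - v n y‖ₑ ^ p) fun n => ?_
          have hm : Measurable fun y : Euc N => ‖v n x - v n y‖ₑ := by
            have := hvc n
            fun_prop
          exact (hm.pow_const p).const_mul _
  calc _ ≤ ∫⁻ x : Euc N, liminf (fun n => ∫⁻ y in ball (0 : Euc N) ρ,
        Wt N a x * ‖v n x - v n y‖ₑ ^ p) atTop := lintegral_mono_ae hinner
    _ ≤ liminf (fun n => ∫⁻ x : Euc N, ∫⁻ y in ball (0 : Euc N) ρ,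
        Wt N a x * ‖v n x - v n y‖ₑ ^ p) atTop :=
        lintegral_liminf_le (f := fun n x => ∫⁻ y in ball (0 : Euc N) ρ,
          Wt N a x * ‖v n x - v n y‖ₑ ^ p) fun n => Measurable.lintegral_prod_right' (hF n)
    _ ≤ liminf (fun _ : ℕ => B) atTop :=
        liminf_le_liminf (Eventually.of_forall hn)
    _ = _ := by simp

lemma weak_bound (N : ℕ) {s p ρ : ℝ} (hs : -1 < s) (hp : 1 ≤ p) (hρ : 0 < ρ) :
    ∃ C : ℝ, 0 < C ∧ ∀ (u : Euc N → ℝ) (g : Fin N → Euc N → ℝ),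
      LocallyIntegrable u volume → (∀ i, IsWeakPartialDeriv i u (g i)) →
      ∫⁻ x : Euc N, ∫⁻ y in ball (0 : Euc N) ρ,
          Wt N (-((s + 1) * p + N)) x * ‖u x - u y‖ₑ ^ p ≤
        ENNReal.ofReal C * ∫⁻ z, Wt N (-(s * p + N)) z * ‖gradNorm1 g z‖ₑ ^ p := by
  have hp0 : 0 < p := by linarith
  obtain ⟨C, hC, hS⟩ := smooth_bound N hs hp hρ
  refine ⟨C * 2 ^ |-(s * p + N)|, by positivity, fun u g hu hg => ?_⟩
  set a : ℝ := -((s + 1) * p + N)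
  set b : ℝ := -(s * p + N)
  have hgm : AEStronglyMeasurable (gradNorm1 g) volume :=
    gradNorm1_meas fun i => (hg i).2.1.aestronglyMeasurable
  let φ : ℕ → ContDiffBump (0 : Euc N) := fun n =>
    ⟨1 / ((n : ℝ) + 1) / 2, 1 / ((n : ℝ) + 1), by positivity, half_lt_self (by positivity)⟩
  have hφ1 : ∀ n, (φ n).rOut ≤ 1 := fun n => by
    change 1 / ((n : ℝ) + 1) ≤ 1
    rw [div_le_one (by positivity)]; linarith [n.cast_nonneg (α := ℝ)]
  let v : ℕ → Euc N → ℝ := fun n =>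
    convolution ((φ n).normed volume) u (ContinuousLinearMap.lsmul ℝ ℝ) volume
  have hv : ∀ n, ContDiff ℝ 1 (v n) := fun n =>
    (φ n).hasCompactSupport_normed.contDiff_convolution_left (n := 1)
      (ContinuousLinearMap.lsmul ℝ ℝ) (φ n).contDiff_normed hu
  have hvc : ∀ n, Continuous (v n) := fun n => (hv n).continuous
  have hconv : ∀ᵐ x : Euc N, Tendsto (fun n => v n x) atTop (𝓝 (u x)) := by
    refine ContDiffBump.ae_convolution_tendsto_right_of_locallyIntegrable (K := 2) (φ := φ) ?_ ?_ hu
    · exact tendsto_one_div_add_atTop_nhds_zero_nat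
    · refine Eventually.of_forall fun n => ?_
      change 1 / ((n : ℝ) + 1) ≤ 2 * (1 / ((n : ℝ) + 1) / 2)
      linarith
  set R := ∫⁻ z, Wt N b z * ‖gradNorm1 g z‖ₑ ^ p with hR
  have hn : ∀ n, ∫⁻ x : Euc N, ∫⁻ y in ball (0 : Euc N) ρ,
      Wt N a x * ‖v n x - v n y‖ₑ ^ p ≤ ENNReal.ofReal (C * 2 ^ |b|) * R := by
    intro n
    calc _ ≤ ENNReal.ofReal C * ∫⁻ z, Wt N b z * ‖fderiv ℝ (v n) z‖ₑ ^ p := hS (v n) (hv n)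
      _ ≤ ENNReal.ofReal C * ∫⁻ z, Wt N b z *
          (∫⁻ y, ENNReal.ofReal ((φ n).normed volume (z - y)) * ‖gradNorm1 g y‖ₑ) ^ p := by
          gcongr with z
          exact mollify_fderiv hu hg (φ n) z
      _ ≤ ENNReal.ofReal C * (ENNReal.ofReal (2 ^ |b|) * R) := by
          gcongr
          exact mollify_weight N hp (φ n) (hφ1 n) _ hgm.enorm
      _ = _ := by rw [ENNReal.ofReal_mul hC.le, mul_assoc]
  exact fatou_bound u v hvc hconv hn

lemma ballAvg_bound {N : ℕ} {p ρ : ℝ} (hp : 1 ≤ p) (hρ : 0 < ρ) (u : Euc N → ℝ)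
    (hu : LocallyIntegrable u volume) (x : Euc N) :
    ‖u x - ballAvg ρ u‖ₑ ^ p ≤
      (volume (ball (0 : Euc N) ρ))⁻¹ * ∫⁻ y in ball (0 : Euc N) ρ, ‖u x - u y‖ₑ ^ p := by
  have hp0 : 0 < p := by linarith
  set V := volume (ball (0 : Euc N) ρ) with hV
  have hV0 : V ≠ 0 := (measure_ball_pos volume 0 hρ).ne'
  have hVt : V ≠ ⊤ := measure_ball_lt_top.ne
  set ν : Measure (Euc N) := V⁻¹ • volume.restrict (ball (0 : Euc N) ρ) with hν
  have hprob : IsProbabilityMeasure ν := ⟨by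
    simp only [hν, Measure.smul_apply, Measure.restrict_apply_univ, smul_eq_mul]
    exact ENNReal.inv_mul_cancel hV0 hVt⟩
  have hui : IntegrableOn u (ball (0 : Euc N) ρ) volume :=
    (hu.integrableOn_isCompact (isCompact_closedBall (0 : Euc N) ρ)).mono_set ball_subset_closedBall
  have huν : Integrable u ν := Integrable.smul_measure hui (by simpa using hV0)
  have hav : u x - ballAvg ρ u = ∫ y, (u x - u y) ∂ν := by
    rw [integral_sub (integrable_const _) huν]
    simp only [integral_const, probReal_univ, one_smul]
    rw [hν, integral_smul_measure, ballAvg, ENNReal.toReal_inv, smul_eq_mul]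
  rw [hav]
  calc _ ≤ (∫⁻ y, ‖u x - u y‖ₑ ∂ν) ^ p := by
        gcongr; exact enorm_integral_le_lintegral_enorm _
    _ ≤ ∫⁻ y, ‖u x - u y‖ₑ ^ p ∂ν := by
        refine jensen_lintegral ν _ ?_ hp
        exact ((integrable_const _).sub huν).aestronglyMeasurable.enorm
    _ = _ := by rw [hν, lintegral_smul_measure, smul_eq_mul]

lemma enorm_wt_mul {N : ℕ} {s p : ℝ} (hp : 1 ≤ p) (f : Euc N → ℝ) (x : Euc N) :
    ‖wt N s (ENNReal.ofReal p) x * f x‖ₑ ^ p = Wt N (-(s * p + N)) x * ‖f x‖ₑ ^ p := by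
  have hp0 : 0 < p := by linarith
  have hx0 : 0 < 1 + ‖x‖ := by positivity
  rw [enorm_mul, ENNReal.mul_rpow_of_nonneg _ _ hp0.le, wt, ENNReal.toReal_ofReal hp0.le]
  congr 1
  rw [Real.enorm_eq_ofReal (by positivity), ENNReal.ofReal_rpow_of_nonneg (by positivity) hp0.le,
    ← Real.rpow_mul hx0.le, Wt]
  congr 2
  field_simp
  ring

lemma eLpNorm_wt {N : ℕ} {s p : ℝ} (hp : 1 ≤ p) (f : Euc N → ℝ) :
    eLpNorm (fun x => wt N s (ENNReal.ofReal p) x * f x) (ENNReal.ofReal p) volume =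
      (∫⁻ x, Wt N (-(s * p + N)) x * ‖f x‖ₑ ^ p) ^ (1 / p) := by
  have hp0 : 0 < p := by linarith
  rw [eLpNorm_eq_lintegral_rpow_enorm_toReal (by simpa using hp0) ENNReal.ofReal_ne_top,
    ENNReal.toReal_ofReal hp0.le]
  simp_rw [enorm_wt_mul hp]

lemma measurable_wt (N : ℕ) (s : ℝ) (q : ℝ≥0∞) : Measurable (wt N s q) := by
  unfold wt; fun_prop

/-- Theorem 3(i). If `s > -1`, `1 ≤ p < ∞` and `∇u ∈ (L^p_s)^N`, then
`u ∈ L^p_{s+1}` and `‖u - c_u‖_{L^p_{s+1}} ≤ C ‖|∇u|‖_{L^p_s}` with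
`c_u = |B_ρ|⁻¹ ∫_{B_ρ} u` and `C = C(s,p)` independent of `u`. -/
theorem stmt_3 {N : ℕ} (hN : 1 ≤ N) (s p ρ : ℝ) (hs : -1 < s) (hp : 1 ≤ p) (hρ : 0 < ρ) :
    ∃ C : ℝ, 0 < C ∧
      ∀ (u : Euc N → ℝ) (g : Fin N → Euc N → ℝ),
        (∀ i, IsWeakPartialDeriv i u (g i)) →
        (∀ i, MemLs N s (ENNReal.ofReal p) (g i)) →
        MemLs N (s + 1) (ENNReal.ofReal p) u ∧
          LsNorm N (s + 1) (ENNReal.ofReal p) (fun x => u x - ballAvg ρ u)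
            ≤ C * LsNorm N s (ENNReal.ofReal p) (gradNorm1 g) := by
  have hp0 : 0 < p := by linarith
  obtain ⟨C, hC, hB⟩ := weak_bound N hs hp hρ
  set V := volume (ball (0 : Euc N) ρ) with hV
  have hV0 : V ≠ 0 := (measure_ball_pos volume 0 hρ).ne'
  have hVt : V ≠ ⊤ := measure_ball_lt_top.ne
  have hVr : 0 < V.toReal := ENNReal.toReal_pos hV0 hVt
  set K : ℝ := V.toReal⁻¹ * C with hK
  have hK0 : 0 < K := by positivity
  refine ⟨K ^ (1 / p), by positivity, fun u g hg hgm => ?_⟩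
  have hu : LocallyIntegrable u volume := (hg ⟨0, hN⟩).1
  set c := ballAvg ρ u with hc
  have key : ∫⁻ x, Wt N (-((s + 1) * p + N)) x * ‖u x - c‖ₑ ^ p ≤
      ENNReal.ofReal K * ∫⁻ z, Wt N (-(s * p + N)) z * ‖gradNorm1 g z‖ₑ ^ p := by
    calc _ ≤ ∫⁻ x : Euc N, V⁻¹ * ∫⁻ y in ball (0 : Euc N) ρ,
          Wt N (-((s + 1) * p + N)) x * ‖u x - u y‖ₑ ^ p := by
          refine lintegral_mono fun x => ?_
          rw [lintegral_const_mul' _ _ (by rw [Wt]; exact ENNReal.ofReal_ne_top), mul_left_comm]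
          refine mul_le_mul_right ?_ _
          exact ballAvg_bound hp hρ u hu x
      _ = V⁻¹ * ∫⁻ x : Euc N, ∫⁻ y in ball (0 : Euc N) ρ,
          Wt N (-((s + 1) * p + N)) x * ‖u x - u y‖ₑ ^ p :=
          lintegral_const_mul' _ _ (by simpa using hV0)
      _ ≤ V⁻¹ * (ENNReal.ofReal C *
          ∫⁻ z, Wt N (-(s * p + N)) z * ‖gradNorm1 g z‖ₑ ^ p) := by
          gcongr; exact hB u g hu hg
      _ = _ := by
          rw [hK, ENNReal.ofReal_mul (by positivity), ENNReal.ofReal_inv_of_pos hVr,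
            ENNReal.ofReal_toReal hVt, mul_assoc]
  have hE : eLpNorm (fun x => wt N (s + 1) (ENNReal.ofReal p) x * (u x - c))
      (ENNReal.ofReal p) volume ≤ ENNReal.ofReal (K ^ (1 / p)) *
      eLpNorm (fun x => wt N s (ENNReal.ofReal p) x * gradNorm1 g x) (ENNReal.ofReal p) volume := by
    rw [eLpNorm_wt hp (fun x => u x - c), eLpNorm_wt hp,
      ← ENNReal.ofReal_rpow_of_nonneg hK0.le (by positivity),
      ← ENNReal.mul_rpow_of_nonneg _ _ (by positivity)]
    exact ENNReal.rpow_le_rpow key (by positivity)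
  have hgrad : MemLp (fun x => wt N s (ENNReal.ofReal p) x * gradNorm1 g x)
      (ENNReal.ofReal p) volume := by
    have hsum : MemLp (fun x => ∑ i, ‖wt N s (ENNReal.ofReal p) x * g i x‖)
        (ENNReal.ofReal p) volume := memLp_finsetSum _ fun i _ => (hgm i).norm
    refine hsum.mono ?_ (Eventually.of_forall fun x => ?_)
    · exact (measurable_wt N s _).aestronglyMeasurable.mul
        (gradNorm1_meas fun i => (hg i).2.1.aestronglyMeasurable)
    · have h0 : gradNorm1 g x ≤ ∑ i, |g i x| := by
        rw [gradNorm1]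
        apply Real.sqrt_le_iff.2
        refine ⟨Finset.sum_nonneg fun i _ => abs_nonneg _, ?_⟩
        calc ∑ i, g i x ^ 2 = ∑ i, |g i x| ^ 2 := by simp
          _ ≤ _ := Finset.sum_sq_le_sq_sum_of_nonneg fun i _ => abs_nonneg _
      have h1 : 0 ≤ gradNorm1 g x := Real.sqrt_nonneg _
      rw [Real.norm_of_nonneg (Finset.sum_nonneg fun i _ => norm_nonneg _), norm_mul,
        Real.norm_of_nonneg h1]
      simp_rw [norm_mul]
      rw [← Finset.mul_sum]
      gcongr
      exact h0
  have hdiff : MemLp (fun x => wt N (s + 1) (ENNReal.ofReal p) x * (u x - c))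
      (ENNReal.ofReal p) volume := by
    refine ⟨(measurable_wt N _ _).aestronglyMeasurable.mul
      (hu.aestronglyMeasurable.sub aestronglyMeasurable_const), hE.trans_lt ?_⟩
    exact ENNReal.mul_lt_top ENNReal.ofReal_lt_top hgrad.2
  have hconst : MemLp (fun x => wt N (s + 1) (ENNReal.ofReal p) x * c)
      (ENNReal.ofReal p) volume := by
    refine ⟨(measurable_wt N _ _).aestronglyMeasurable.mul aestronglyMeasurable_const, ?_⟩
    rw [eLpNorm_wt hp (fun _ => c)]
    refine ENNReal.rpow_lt_top_of_nonneg (by positivity) (ne_of_lt ?_)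
    rw [lintegral_mul_const _ (measurable_Wt N _)]
    refine ENNReal.mul_lt_top ?_ (ENNReal.rpow_lt_top_of_nonneg hp0.le (by simp))
    refine finite_integral_one_add_norm (r := (s + 1) * p + N) ?_
    have : 0 < (s + 1) * p := mul_pos (by linarith) hp0
    simpa using this
  refine ⟨?_, ?_⟩
  · have := hdiff.add hconst
    unfold MemLs
    convert this using 1
    funext x
    simp only [Pi.add_apply]
    ring
  · unfold LsNorm
    have := ENNReal.toReal_mono
      (ENNReal.mul_lt_top ENNReal.ofReal_lt_top hgrad.2).ne hE
    rwa [ENNReal.toReal_mul, ENNReal.toReal_ofReal (by positivity)] at this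

end
end
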